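/- There exists a unique skew-dual pairing ⟨,⟩ : B'(sp_{2n}) × B(sp_{2n}) → ℚ(r,s) of the Hopf algebras B(sp_{2n}) and B'(sp_{2n}) such that: ⟨f_i, e_j⟩ = δ_{ij}/(s_i − r_i); ⟨ω_i', ω_j⟩ = r^{(ε_j,α_i)}s^{(ε_{j+1},α_i)} for i ≤ n and j < n; ⟨ω_i', ω_n⟩ = r^{2(ε_n,α_i)} for i < n; ⟨ω_n', ω_n⟩ = r^{(ε_n,α_n)}s^{-(ε_n,α_n)} = r²s^{-2}; ⟨ω_i'^{±1}, ω_j^{-1}⟩ = ⟨ω_i'^{±1}, ω_j⟩^{-1} = ⟨ω_i', ω_j⟩^{∓1}; and all other pairs of generators pair to 0. Moreover this pairing satisfies ⟨S(a), S(b)⟩ = ⟨a, b⟩ for all a ∈ B'(sp_{2n}), b ∈ B(sp_{2n}). -/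

import Mathlib

/-!
STATEMENT 5.  There exists a unique skew-dual pairing
⟨,⟩ : B'(sp_{2n}) × B(sp_{2n}) → ℚ(r,s) of the Hopf algebras B(sp_{2n})
(generated by the e_j, ω_j^{±1}) and B'(sp_{2n}) (generated by the f_j, ω_j'^{±1}),
with the prescribed values on generators, all other pairs of generators pairing to 0;
moreover the pairing satisfies ⟨S(a), S(b)⟩ = ⟨a, b⟩.  (Type Cₙ; the rank is n+1 for
a parameter n : ℕ and all indices are 0-based, the last simple root being α_n = 2ε_n.)
-/

noncomputable section
open scoped TensorProduct

/-- K = ℚ(r,s) -/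
abbrev KK : Type := FractionRing (MvPolynomial (Fin 2) ℚ)
def qr : KK := algebraMap (MvPolynomial (Fin 2) ℚ) KK (MvPolynomial.X 0)
def qs : KK := algebraMap (MvPolynomial (Fin 2) ℚ) KK (MvPolynomial.X 1)

/-- generators e_i, ω_i^{±1} of the positive Hopf subalgebra B -/
inductive GenE (N : ℕ) | e (i : Fin N) | w (i : Fin N) | winv (i : Fin N)

/-- generators f_i, ω_i'^{±1} of the negative Hopf subalgebra B' -/
inductive GenF (N : ℕ) | f (i : Fin N) | wp (i : Fin N) | wpinv (i : Fin N)

def GenE.toral {N : ℕ} : GenE N → Prop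
  | .e _ => False
  | _ => True

def GenF.toral {N : ℕ} : GenF N → Prop
  | .f _ => False
  | _ => True

/-- (ε_j, α_i) for type Cₙ of rank n+1 (0-indexed). -/
def ipaC (n : ℕ) (j i : ℕ) : ℤ :=
  if i < n then (if j = i then 1 else 0) - (if j = i+1 then 1 else 0)
  else (if j = n then 2 else 0)

/-- r_i = r^{(α_i,α_i)/2} -/
def riC (n : ℕ) (ρ : KK) (i : ℕ) : KK := if i < n then ρ else ρ^2

/-- the pairing values ⟨ω_i', ω_j⟩ of Proposition 2.3 (4C) -/
def cstC (n : ℕ) (i j : Fin (n+1)) : KK :=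
  if (j:ℕ) < n then qr^(ipaC n j i) * qs^(ipaC n ((j:ℕ)+1) i)
  else if (i:ℕ) < n then qr^(2 * ipaC n n i)
  else qr^2 * qs^(-2:ℤ)

abbrev FE (n : ℕ) : Type := FreeAlgebra KK (GenE (n+1))
abbrev FF (n : ℕ) : Type := FreeAlgebra KK (GenF (n+1))
abbrev XE {n : ℕ} : GenE (n+1) → FE n := FreeAlgebra.ι KK
abbrev XF {n : ℕ} : GenF (n+1) → FF n := FreeAlgebra.ι KK

/-- the defining relations of B(sp_{2(n+1)}) -/
inductive RelCE (n : ℕ) : FE n → FE n → Prop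
  | comm (g g' : GenE (n+1)) (hg : g.toral) (hg' : g'.toral) :
      RelCE n (XE g * XE g') (XE g' * XE g)
  | winv_r (i : Fin (n+1)) : RelCE n (XE (.w i) * XE (.winv i)) 1
  | winv_l (i : Fin (n+1)) : RelCE n (XE (.winv i) * XE (.w i)) 1
  | c2we (i j : Fin (n+1)) (hj : (j:ℕ) < n) :
      RelCE n (XE (.w j) * XE (.e i) * XE (.winv j))
        ((qr^(ipaC n j i) * qs^(ipaC n ((j:ℕ)+1) i)) • XE (.e i))
  | c2wne (j : Fin (n+1)) (hj : (j:ℕ) < n) :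
      RelCE n (XE (.w (Fin.last n)) * XE (.e j) * XE (.winv (Fin.last n)))
        ((qr^(2 * ipaC n n j)) • XE (.e j))
  | c2wnen :
      RelCE n (XE (.w (Fin.last n)) * XE (.e (Fin.last n)) * XE (.winv (Fin.last n)))
        ((qr^2 * qs^(-2:ℤ)) • XE (.e (Fin.last n)))
  | c5e (i j : Fin (n+1)) (h : (i:ℕ)+1 < j ∨ (j:ℕ)+1 < i) :
      RelCE n (XE (.e i) * XE (.e j) - XE (.e j) * XE (.e i)) 0
  | c6a (i j : Fin (n+1)) (hij : (j:ℕ) = (i:ℕ)+1) (h : (i:ℕ)+1 < n) :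
      RelCE n (XE (.e i)^2 * XE (.e j) - (qr + qs) • (XE (.e i) * XE (.e j) * XE (.e i))
        + (qr*qs) • (XE (.e j) * XE (.e i)^2)) 0
  | c6b (i j : Fin (n+1)) (hij : (j:ℕ) = (i:ℕ)+1) (h : (i:ℕ)+1 < n) :
      RelCE n (XE (.e j)^2 * XE (.e i) - (qr⁻¹ + qs⁻¹) • (XE (.e j) * XE (.e i) * XE (.e j))
        + (qr*qs)⁻¹ • (XE (.e i) * XE (.e j)^2)) 0
  | c6c (i : Fin (n+1)) (h : (i:ℕ)+1 = n) :
      RelCE n (XE (.e i)^3 * XE (.e (Fin.last n))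
        - (qr^2 + qr*qs + qs^2) • (XE (.e i)^2 * XE (.e (Fin.last n)) * XE (.e i))
        + (qr*qs*(qr^2 + qr*qs + qs^2)) • (XE (.e i) * XE (.e (Fin.last n)) * XE (.e i)^2)
        - (qr*qs)^3 • (XE (.e (Fin.last n)) * XE (.e i)^3)) 0
  | c6d (i : Fin (n+1)) (h : (i:ℕ)+1 = n) :
      RelCE n (XE (.e (Fin.last n))^2 * XE (.e i)
        - ((riC n qr n)⁻¹ + (riC n qs n)⁻¹) • (XE (.e (Fin.last n)) * XE (.e i) * XE (.e (Fin.last n)))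
        + (riC n qr n * riC n qs n)⁻¹ • (XE (.e i) * XE (.e (Fin.last n))^2)) 0

/-- the defining relations of B'(sp_{2(n+1)}) -/
inductive RelCF (n : ℕ) : FF n → FF n → Prop
  | comm (g g' : GenF (n+1)) (hg : g.toral) (hg' : g'.toral) :
      RelCF n (XF g * XF g') (XF g' * XF g)
  | wpinv_r (i : Fin (n+1)) : RelCF n (XF (.wp i) * XF (.wpinv i)) 1
  | wpinv_l (i : Fin (n+1)) : RelCF n (XF (.wpinv i) * XF (.wp i)) 1
  | c3wpf (i j : Fin (n+1)) (hj : (j:ℕ) < n) :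
      RelCF n (XF (.wp j) * XF (.f i) * XF (.wpinv j))
        ((qs^(-(ipaC n j i)) * qr^(-(ipaC n ((j:ℕ)+1) i))) • XF (.f i))
  | c3wpnf (j : Fin (n+1)) (hj : (j:ℕ) < n) :
      RelCF n (XF (.wp (Fin.last n)) * XF (.f j) * XF (.wpinv (Fin.last n)))
        ((qs^(-(2 * ipaC n n j))) • XF (.f j))
  | c3wpnfn :
      RelCF n (XF (.wp (Fin.last n)) * XF (.f (Fin.last n)) * XF (.wpinv (Fin.last n)))
        ((qs^(-2:ℤ) * qr^2) • XF (.f (Fin.last n)))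
  | c5f (i j : Fin (n+1)) (h : (i:ℕ)+1 < j ∨ (j:ℕ)+1 < i) :
      RelCF n (XF (.f i) * XF (.f j) - XF (.f j) * XF (.f i)) 0
  | c7a (i j : Fin (n+1)) (hij : (j:ℕ) = (i:ℕ)+1) (h : (i:ℕ)+1 < n) :
      RelCF n (XF (.f j) * XF (.f i)^2 - (qr + qs) • (XF (.f i) * XF (.f j) * XF (.f i))
        + (qr*qs) • (XF (.f i)^2 * XF (.f j))) 0
  | c7b (i j : Fin (n+1)) (hij : (j:ℕ) = (i:ℕ)+1) (h : (i:ℕ)+1 < n) :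
      RelCF n (XF (.f i) * XF (.f j)^2 - (qr⁻¹ + qs⁻¹) • (XF (.f j) * XF (.f i) * XF (.f j))
        + (qr*qs)⁻¹ • (XF (.f j)^2 * XF (.f i))) 0
  | c7c (i : Fin (n+1)) (h : (i:ℕ)+1 = n) :
      RelCF n (XF (.f (Fin.last n)) * XF (.f i)^3
        - (qr^2 + qr*qs + qs^2) • (XF (.f i) * XF (.f (Fin.last n)) * XF (.f i)^2)
        + (qr*qs*(qr^2 + qr*qs + qs^2)) • (XF (.f i)^2 * XF (.f (Fin.last n)) * XF (.f i))
        - (qr*qs)^3 • (XF (.f i)^3 * XF (.f (Fin.last n)))) 0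
  | c7d (i : Fin (n+1)) (h : (i:ℕ)+1 = n) :
      RelCF n (XF (.f i) * XF (.f (Fin.last n))^2
        - ((riC n qr n)⁻¹ + (riC n qs n)⁻¹) • (XF (.f (Fin.last n)) * XF (.f i) * XF (.f (Fin.last n)))
        + (riC n qr n * riC n qs n)⁻¹ • (XF (.f (Fin.last n))^2 * XF (.f i))) 0

/-- the Hopf subalgebra B (upper part) -/
abbrev BA (n : ℕ) : Type := RingQuot (RelCE n)
/-- the Hopf subalgebra B' (lower part) -/
abbrev BA' (n : ℕ) : Type := RingQuot (RelCF n)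

def genBE (n : ℕ) (g : GenE (n+1)) : BA n := RingQuot.mkAlgHom KK (RelCE n) (XE g)
def genBF (n : ℕ) (g : GenF (n+1)) : BA' n := RingQuot.mkAlgHom KK (RelCF n) (XF g)

/-- the conditions defining the skew-dual pairing ⟨,⟩ : B' × B → K of Proposition 2.3:
it is a dual pairing of B'^{cop} and B, with the prescribed values on generators
(all other pairs of generators pairing to 0). -/
def PairCond (n : ℕ) (ΔB : BA n →ₐ[KK] (BA n ⊗[KK] BA n)) (εB : BA n →ₐ[KK] KK)
    (ΔB' : BA' n →ₐ[KK] (BA' n ⊗[KK] BA' n)) (εB' : BA' n →ₐ[KK] KK)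
    (p : BA' n →ₗ[KK] BA n →ₗ[KK] KK) : Prop :=
  (∀ f, p f 1 = εB' f) ∧ (∀ a, p 1 a = εB a) ∧
  (∀ f a a', p f (a * a')
    = LinearMap.mul' KK KK ((TensorProduct.map (p.flip a') (p.flip a)) (ΔB'.toLinearMap f))) ∧
  (∀ f f' a, p (f * f') a
    = LinearMap.mul' KK KK ((TensorProduct.map (p f) (p f')) (ΔB.toLinearMap a))) ∧
  (∀ i j, p (genBF n (.f i)) (genBE n (.e j))
    = if i = j then (riC n qs i - riC n qr i)⁻¹ else 0) ∧
  (∀ i j, p (genBF n (.wp i)) (genBE n (.w j)) = cstC n i j) ∧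
  (∀ i j, p (genBF n (.wp i)) (genBE n (.winv j)) = (cstC n i j)⁻¹) ∧
  (∀ i j, p (genBF n (.wpinv i)) (genBE n (.w j)) = (cstC n i j)⁻¹) ∧
  (∀ i j, p (genBF n (.wpinv i)) (genBE n (.winv j)) = cstC n i j) ∧
  (∀ i j, p (genBF n (.f i)) (genBE n (.w j)) = 0) ∧
  (∀ i j, p (genBF n (.f i)) (genBE n (.winv j)) = 0) ∧
  (∀ i j, p (genBF n (.wp i)) (genBE n (.e j)) = 0) ∧
  (∀ i j, p (genBF n (.wpinv i)) (genBE n (.e j)) = 0)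

section QSerre

variable {K : Type} [Field K] {A B : Type} [Ring A] [Algebra K A] [Ring B] [Algebra K B]

/-- The iterated `q`-commutator `(ad x)^m y`, the `m`-th step being
`z ↦ x z - b q^m z x`. -/
def qSerre (b q : K) (x y : A) : ℕ → A
  | 0 => y
  | m + 1 => x * qSerre b q x y m - (b * q ^ m) • (qSerre b q x y m * x)

theorem map_qSerre (φ : A →ₐ[K] B) (b q : K) (x y : A) (m : ℕ) :
    φ (qSerre b q x y m) = qSerre b q (φ x) (φ y) m := by
  induction m with
  | zero => rfl
  | succ m ih => simp [qSerre, ih]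

theorem qSerre_add_right (b q : K) (x y v : A) (m : ℕ) :
    qSerre b q x (y + v) m = qSerre b q x y m + qSerre b q x v m := by
  induction m with
  | zero => rfl
  | succ m ih => simp only [qSerre, ih, mul_add, add_mul, smul_add]; abel

theorem qSerre_zero_right (b q : K) (x : A) (m : ℕ) : qSerre b q x 0 m = 0 := by
  induction m with
  | zero => rfl
  | succ m ih => simp [qSerre, ih]

theorem qSerre_zero_left (b q : K) (y : A) {m : ℕ} (hm : 1 ≤ m) : qSerre b q 0 y m = 0 := by
  obtain ⟨m, rfl⟩ := Nat.exists_eq_add_of_le' hm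
  simp [qSerre]

theorem mul_qSerre {b q : K} {x y u : A} (hx : u * x = q • (x * u)) (hy : u * y = b • (y * u))
    (m : ℕ) : u * qSerre b q x y m = (b * q ^ m) • (qSerre b q x y m * u) := by
  induction m with
  | zero => simpa [qSerre] using hy
  | succ m ih =>
    have h1 : u * (x * qSerre b q x y m) = (b * q ^ (m + 1)) • (x * qSerre b q x y m * u) := by
      rw [← mul_assoc, hx, smul_mul_assoc, mul_assoc, ih, mul_smul_comm, smul_smul, mul_assoc]
      congr 1; ring
    have h2 : u * (qSerre b q x y m * x) = (b * q ^ (m + 1)) • (qSerre b q x y m * x * u) := by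
      rw [← mul_assoc, ih, smul_mul_assoc, mul_assoc, hx, mul_smul_comm, smul_smul, ← mul_assoc]
      congr 1; ring
    simp only [qSerre, mul_sub, mul_smul_comm, h1, h2, sub_mul, smul_mul_assoc]
    module

theorem qSerre_add_left {b q : K} {x y u : A} (hx : u * x = q • (x * u))
    (hy : u * y = b • (y * u)) (m : ℕ) : qSerre b q (x + u) y m = qSerre b q x y m := by
  induction m with
  | zero => rfl
  | succ m ih =>
    simp only [qSerre, ih, add_mul, mul_add, mul_qSerre hx hy]
    module

theorem qSerre_add_left' {b b' q : K} {x u v : A} (hb : b ≠ 0) (hq : q ≠ 0) {m : ℕ}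
    (hm : 1 ≤ m) (hm' : m ≤ 3) (h : b * b' * q ^ (m - 1) = 1) (hx : u * x = q • (x * u))
    (hv : v * x = b' • (x * v)) : qSerre b q (x + u) v m = qSerre b q u v m := by
  have hx' (t : A) : u * (x * t) = q • (x * (u * t)) := by
    rw [← mul_assoc, hx, smul_mul_assoc, mul_assoc]
  have hv' (t : A) : v * (x * t) = b' • (x * (v * t)) := by
    rw [← mul_assoc, hv, smul_mul_assoc, mul_assoc]
  obtain rfl : b' = (b * q ^ (m - 1))⁻¹ := by
    field_simp; linear_combination h
  interval_cases m <;>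
  · simp only [qSerre, mul_sub, sub_mul, mul_add, add_mul, mul_assoc, hx, hx', hv, hv',
      smul_mul_assoc, mul_smul_comm, smul_smul, smul_add, smul_sub]
    match_scalars <;> field_simp <;> ring

theorem qSerre_add {b b' q : K} {x y u v : A} (hb : b ≠ 0) (hq : q ≠ 0) {m : ℕ}
    (hm : 1 ≤ m) (hm' : m ≤ 3) (h : b * b' * q ^ (m - 1) = 1) (hx : u * x = q • (x * u))
    (hy : u * y = b • (y * u)) (hv : v * x = b' • (x * v)) :
    qSerre b q (x + u) (y + v) m = qSerre b q x y m + qSerre b q u v m := by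
  rw [qSerre_add_right, qSerre_add_left hx hy, qSerre_add_left' hb hq hm hm' h hx hv]

theorem qSerre_smul (b q c d : K) (x y : A) (m : ℕ) :
    qSerre b q (c • x) (d • y) m = (c ^ m * d) • qSerre b q x y m := by
  induction m with
  | zero => simp [qSerre]
  | succ m ih =>
    simp only [qSerre, ih, smul_mul_assoc, mul_smul_comm]
    module

theorem qSerre_tmul_left {b q : K} {g h : A} (hgh : g * h = h * g) (x y : B) (m : ℕ) :
    qSerre b q (g ⊗ₜ[K] x) (h ⊗ₜ[K] y) m = (g ^ m * h) ⊗ₜ[K] qSerre b q x y m := by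
  induction m with
  | zero => simp [qSerre]
  | succ m ih =>
    have h1 : g ^ m * h * g = g ^ (m + 1) * h := by rw [mul_assoc, ← hgh, pow_succ, mul_assoc]
    simp only [qSerre, ih, Algebra.TensorProduct.tmul_mul_tmul, h1, TensorProduct.tmul_sub,
      TensorProduct.tmul_smul, ← mul_assoc, ← pow_succ']

theorem qSerre_tmul_right {b q : K} {g h : A} (hgh : g * h = h * g) (x y : B) (m : ℕ) :
    qSerre b q (x ⊗ₜ[K] g) (y ⊗ₜ[K] h) m = qSerre b q x y m ⊗ₜ[K] (g ^ m * h) := by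
  induction m with
  | zero => simp [qSerre]
  | succ m ih =>
    have h1 : g ^ m * h * g = g ^ (m + 1) * h := by rw [mul_assoc, ← hgh, pow_succ, mul_assoc]
    simp only [qSerre, ih, Algebra.TensorProduct.tmul_mul_tmul, h1, TensorProduct.sub_tmul,
      TensorProduct.smul_tmul', ← mul_assoc, ← pow_succ']

/-- Serre relations are stable under the antipode `x ↦ -g x`. -/
theorem qSerre_op_left {b b' q : K} {x y g h : A} (hb : b ≠ 0) (hq : q ≠ 0) {m : ℕ}
    (hm : 1 ≤ m) (hm' : m ≤ 3) (hbb : b * b' * q ^ (m - 1) = 1) (hgh : h * g = g * h)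
    (hxg : x * g = q • (g * x)) (hyg : y * g = b • (g * y)) (hxh : x * h = b' • (h * x))
    (h0 : qSerre b q x y m = 0) :
    qSerre b q (MulOpposite.op (-(g * x))) (MulOpposite.op (-(h * y))) m = 0 := by
  have hgh' (t : A) : h * (g * t) = g * (h * t) := by rw [← mul_assoc, hgh, mul_assoc]
  have hxg' (t : A) : x * (g * t) = q • (g * (x * t)) := by
    rw [← mul_assoc, hxg, smul_mul_assoc, mul_assoc]
  have hyg' (t : A) : y * (g * t) = b • (g * (y * t)) := by
    rw [← mul_assoc, hyg, smul_mul_assoc, mul_assoc]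
  have hxh' (t : A) : x * (h * t) = b' • (h * (x * t)) := by
    rw [← mul_assoc, hxh, smul_mul_assoc, mul_assoc]
  obtain rfl : b' = (b * q ^ (m - 1))⁻¹ := by
    field_simp; linear_combination hbb
  apply MulOpposite.unop_injective
  trans -((g ^ m * h) * qSerre b q x y m)
  · interval_cases m <;>
    · simp only [qSerre, MulOpposite.unop_sub, MulOpposite.unop_smul, MulOpposite.unop_mul,
        MulOpposite.unop_op, mul_neg, neg_mul, neg_neg, smul_neg, pow_succ, pow_zero, one_mul,
        mul_sub, sub_mul, mul_assoc, hgh', hxg', hyg', hxh', smul_mul_assoc, mul_smul_comm,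
        smul_smul, smul_sub]
      match_scalars <;> field_simp <;> ring
  · rw [h0, mul_zero, neg_zero, MulOpposite.unop_zero]

end QSerre

section QBorel

variable {K : Type} [Field K] {ι : Type} {A B : Type} [Ring A] [Algebra K A] [Ring B] [Algebra K B]

/-- Braiding constants compatible with the Serre exponents `m i j = 1 - a i j ∈ {1, 2, 3}`. -/
structure SerreDatum (m : ι → ι → ℕ) (q : ι → ι → K) : Prop where
  ne_zero : ∀ i j, q i j ≠ 0
  one_le : ∀ i j, 1 ≤ m i j
  le_three : ∀ i j, m i j ≤ 3
  mul_eq_one : ∀ i j, i ≠ j → q i j * q j i * q i i ^ (m i j - 1) = 1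

theorem SerreDatum.transpose {m : ι → ι → ℕ} {q : ι → ι → K} (h : SerreDatum m q) :
    SerreDatum m fun i j => q j i where
  ne_zero i j := h.ne_zero j i
  one_le := h.one_le
  le_three := h.le_three
  mul_eq_one i j hij := by rw [mul_comm (q j i)]; exact h.mul_eq_one i j hij

/-- Commuting invertible elements `k i` with inverses `l i`, and eigenvectors `x j` for
conjugation by them. -/
structure QWeight (q : ι → ι → K) (x k l : ι → A) : Prop where
  comm : ∀ i j, k i * k j = k j * k i
  mul_inv : ∀ i, k i * l i = 1
  inv_mul : ∀ i, l i * k i = 1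
  weight : ∀ i j, k i * x j = q i j • (x j * k i)

/-- The defining relations of a quantum Borel algebra. -/
structure QBorel (m : ι → ι → ℕ) (q : ι → ι → K) (x k l : ι → A) : Prop
    extends QWeight q x k l where
  serre : ∀ i j, i ≠ j → qSerre (q i j) (q i i) (x i) (x j) (m i j) = 0

/-- `A` is presented by the generators `x`, `k`, `l` and the relations `QBorel`. -/
structure QBorelPresentation (m : ι → ι → ℕ) (q : ι → ι → K) (x k l : ι → A) : Prop
    extends QBorel m q x k l where
  adjoin_eq_top : Algebra.adjoin K (Set.range x ∪ Set.range k ∪ Set.range l) = ⊤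
  lift : ∀ (C : Type) [Ring C] [Algebra K C] (x' k' l' : ι → C), QBorel m q x' k' l' →
    ∃ φ : A →ₐ[K] C, (∀ i, φ (x i) = x' i) ∧ (∀ i, φ (k i) = k' i) ∧ ∀ i, φ (l i) = l' i

variable {m : ι → ι → ℕ} {q : ι → ι → K} {x k l : ι → A}

namespace QWeight

theorem mul_inv_comm (h : QWeight q x k l) (i j : ι) : k i * l j = l j * k i := by
  calc k i * l j = l j * (k j * k i) * l j := by
        rw [← mul_assoc, h.inv_mul, one_mul]
    _ = l j * k i := by rw [h.comm j i, mul_assoc, mul_assoc, h.mul_inv, mul_one]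

theorem inv_comm (h : QWeight q x k l) (i j : ι) : l i * l j = l j * l i := by
  calc l i * l j = l j * (k j * l i) * l j := by
        rw [← mul_assoc, h.inv_mul, one_mul]
    _ = l j * l i := by rw [h.mul_inv_comm j i, mul_assoc, mul_assoc, h.mul_inv, mul_one]

theorem weight_inv (h : QWeight q x k l) (i j : ι) : x j * l i = q i j • (l i * x j) := by
  calc x j * l i = l i * (k i * x j) * l i := by
        rw [← mul_assoc, h.inv_mul, one_mul]
    _ = q i j • (l i * x j) := by
        rw [h.weight, mul_smul_comm, smul_mul_assoc, mul_assoc, mul_assoc, h.mul_inv, mul_one]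

theorem tmul (h : QWeight q x k l) : QWeight (A := A ⊗[K] A) q
    (fun i => x i ⊗ₜ 1 + k i ⊗ₜ x i) (fun i => k i ⊗ₜ k i) (fun i => l i ⊗ₜ l i) where
  comm i j := by simp only [Algebra.TensorProduct.tmul_mul_tmul, h.comm i j]
  mul_inv i := by
    simp only [Algebra.TensorProduct.tmul_mul_tmul, h.mul_inv, Algebra.TensorProduct.one_def]
  inv_mul i := by
    simp only [Algebra.TensorProduct.tmul_mul_tmul, h.inv_mul, Algebra.TensorProduct.one_def]
  weight i j := by
    simp only [mul_add, add_mul, Algebra.TensorProduct.tmul_mul_tmul, h.weight i j, h.comm i j,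
      mul_one, one_mul, TensorProduct.smul_tmul', TensorProduct.tmul_smul, smul_add]

theorem tmul_rev (h : QWeight q x k l) : QWeight (A := A ⊗[K] A) q
    (fun i => 1 ⊗ₜ x i + x i ⊗ₜ k i) (fun i => k i ⊗ₜ k i) (fun i => l i ⊗ₜ l i) where
  comm i j := by simp only [Algebra.TensorProduct.tmul_mul_tmul, h.comm i j]
  mul_inv i := by
    simp only [Algebra.TensorProduct.tmul_mul_tmul, h.mul_inv, Algebra.TensorProduct.one_def]
  inv_mul i := by
    simp only [Algebra.TensorProduct.tmul_mul_tmul, h.inv_mul, Algebra.TensorProduct.one_def]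
  weight i j := by
    simp only [mul_add, add_mul, Algebra.TensorProduct.tmul_mul_tmul, h.weight i j, h.comm i j,
      mul_one, one_mul, TensorProduct.smul_tmul', TensorProduct.tmul_smul, smul_add]

/-- Serre elements are skew-primitive. -/
theorem qSerre_tmul (h : QWeight q x k l) (hq : SerreDatum m q) {i j : ι} (hij : i ≠ j) :
    qSerre (q i j) (q i i) (x i ⊗ₜ[K] (1 : A) + k i ⊗ₜ[K] x i) (x j ⊗ₜ[K] 1 + k j ⊗ₜ[K] x j)
        (m i j) =
      qSerre (q i j) (q i i) (x i) (x j) (m i j) ⊗ₜ[K] 1 +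
        (k i ^ m i j * k j) ⊗ₜ[K] qSerre (q i j) (q i i) (x i) (x j) (m i j) := by
  have hw (i j : ι) : k i ⊗ₜ[K] x i * x j ⊗ₜ[K] (1 : A) =
      q i j • (x j ⊗ₜ[K] (1 : A) * k i ⊗ₜ[K] x i) := by
    simp only [Algebra.TensorProduct.tmul_mul_tmul, h.weight i j, mul_one, one_mul,
      TensorProduct.smul_tmul']
  rw [qSerre_add (hq.ne_zero i j) (hq.ne_zero i i) (hq.one_le i j) (hq.le_three i j)
    (hq.mul_eq_one i j hij) (hw i i) (hw i j) (hw j i), qSerre_tmul_left (h.comm i j)]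
  congr 1
  exact (map_qSerre (Algebra.TensorProduct.includeLeft : A →ₐ[K] A ⊗[K] A) _ _ _ _ _).symm

/-- Serre elements are skew-primitive for the opposite coproduct. -/
theorem qSerre_tmul_rev (h : QWeight q x k l) (hq : SerreDatum m q) {i j : ι} (hij : i ≠ j) :
    qSerre (q i j) (q i i) ((1 : A) ⊗ₜ[K] x i + x i ⊗ₜ[K] k i) (1 ⊗ₜ[K] x j + x j ⊗ₜ[K] k j)
        (m i j) =
      1 ⊗ₜ[K] qSerre (q i j) (q i i) (x i) (x j) (m i j) +
        qSerre (q i j) (q i i) (x i) (x j) (m i j) ⊗ₜ[K] (k i ^ m i j * k j) := by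
  have hw (i j : ι) : x i ⊗ₜ[K] k i * (1 : A) ⊗ₜ[K] x j =
      q i j • ((1 : A) ⊗ₜ[K] x j * x i ⊗ₜ[K] k i) := by
    simp only [Algebra.TensorProduct.tmul_mul_tmul, h.weight i j, mul_one, one_mul,
      TensorProduct.tmul_smul]
  rw [qSerre_add (hq.ne_zero i j) (hq.ne_zero i i) (hq.one_le i j) (hq.le_three i j)
    (hq.mul_eq_one i j hij) (hw i i) (hw i j) (hw j i), qSerre_tmul_right (h.comm i j)]
  congr 1
  exact (map_qSerre (Algebra.TensorProduct.includeRight : A →ₐ[K] A ⊗[K] A) _ _ _ _ _).symm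

end QWeight

namespace QBorel

theorem tmul (h : QBorel m q x k l) (hq : SerreDatum m q) : QBorel (A := A ⊗[K] A) m q
    (fun i => x i ⊗ₜ 1 + k i ⊗ₜ x i) (fun i => k i ⊗ₜ k i) (fun i => l i ⊗ₜ l i) where
  toQWeight := h.toQWeight.tmul
  serre i j hij := by rw [h.qSerre_tmul hq hij, h.serre i j hij]; simp

theorem tmul_rev (h : QBorel m q x k l) (hq : SerreDatum m q) : QBorel (A := A ⊗[K] A) m q
    (fun i => 1 ⊗ₜ x i + x i ⊗ₜ k i) (fun i => k i ⊗ₜ k i) (fun i => l i ⊗ₜ l i) where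
  toQWeight := h.toQWeight.tmul_rev
  serre i j hij := by rw [h.qSerre_tmul_rev hq hij, h.serre i j hij]; simp

theorem scalar : QBorel (A := K) m q (fun _ => 0) (fun _ => 1) (fun _ => 1) where
  comm i j := rfl
  mul_inv i := one_mul 1
  inv_mul i := one_mul 1
  weight i j := by simp
  serre i j hij := qSerre_zero_right _ _ _ _

theorem smul_left (h : QBorel m q x k l) (c : ι → K) :
    QBorel m q (fun i => c i • x i) k l where
  comm := h.comm
  mul_inv := h.mul_inv
  inv_mul := h.inv_mul
  weight i j := by rw [mul_smul_comm, h.weight, smul_mul_assoc, smul_comm]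
  serre i j hij := by rw [qSerre_smul, h.serre i j hij, smul_zero]

theorem op_left (h : QBorel m q x k l) (hq : SerreDatum m q) : QBorel (A := Aᵐᵒᵖ) m q
    (fun i => MulOpposite.op (-(l i * x i))) (fun i => MulOpposite.op (l i))
    (fun i => MulOpposite.op (k i)) where
  comm i j := by simp only [← MulOpposite.op_mul, h.inv_comm i j]
  mul_inv i := by simp only [← MulOpposite.op_mul, h.mul_inv, MulOpposite.op_one]
  inv_mul i := by simp only [← MulOpposite.op_mul, h.inv_mul, MulOpposite.op_one]
  weight i j := by
    rw [← MulOpposite.op_mul, ← MulOpposite.op_mul, ← MulOpposite.op_smul, neg_mul, mul_neg,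
      smul_neg, mul_assoc, h.weight_inv, mul_smul_comm, ← mul_assoc, ← mul_assoc, h.inv_comm i j]
  serre i j hij := qSerre_op_left (hq.ne_zero i j) (hq.ne_zero i i) (hq.one_le i j)
    (hq.le_three i j) (hq.mul_eq_one i j hij) (h.inv_comm j i) (h.weight_inv i i)
    (h.weight_inv i j) (h.weight_inv j i) (h.serre i j hij)

theorem op_right (h : QBorel m q x k l) (hq : SerreDatum m q) : QBorel (A := Aᵐᵒᵖ) m q
    (fun i => MulOpposite.op (-(x i * l i))) (fun i => MulOpposite.op (l i))
    (fun i => MulOpposite.op (k i)) := by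
  convert (h.op_left hq).smul_left (fun i => q i i) using 2 with i
  rw [h.weight_inv, ← MulOpposite.op_smul, smul_neg]

/-- Rescaling the toral elements. -/
theorem twist (h : QBorel m q x k l) {t : ι → K} (ht : ∀ i, t i ≠ 0) :
    QBorel m q x (fun i => t i • k i) (fun i => (t i)⁻¹ • l i) where
  comm i j := by
    simp only [smul_mul_assoc, mul_smul_comm, h.comm i j, smul_comm (t i) (t j)]
  mul_inv i := by
    simp only [smul_mul_assoc, mul_smul_comm, h.mul_inv, smul_smul]
    rw [inv_mul_cancel₀ (ht i), one_smul]
  inv_mul i := by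
    simp only [smul_mul_assoc, mul_smul_comm, h.inv_mul, smul_smul]
    rw [mul_inv_cancel₀ (ht i), one_smul]
  weight i j := by simp only [smul_mul_assoc, mul_smul_comm, h.weight i j, smul_comm (t i)]
  serre := h.serre

/-- The upper triangular matrices encoding a skew derivation `x i ↦ μ k i`. -/
theorem matrix [DecidableEq ι] (h : QBorel m q x k l) (hq : SerreDatum m q) (i : ι) (μ : K) :
    QBorel (A := Matrix (Fin 2) (Fin 2) A) m q
      (fun j => !![x j, if j = i then μ • k i else 0; 0, x j])
      (fun j => !![q j i • k j, 0; 0, k j])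
      (fun j => !![(q j i)⁻¹ • l j, 0; 0, l j]) where
  comm a b := by
    simp only [Matrix.mul_fin_two, smul_mul_assoc, mul_smul_comm, h.comm a b, mul_zero, zero_mul,
      add_zero, zero_add, smul_zero, smul_comm (q a i)]
  mul_inv a := by
    simp only [Matrix.mul_fin_two, smul_mul_assoc, mul_smul_comm, h.mul_inv, mul_zero, zero_mul,
      add_zero, zero_add, smul_zero, smul_smul, inv_mul_cancel₀ (hq.ne_zero a i), one_smul,
      Matrix.one_fin_two]
  inv_mul a := by
    simp only [Matrix.mul_fin_two, smul_mul_assoc, mul_smul_comm, h.inv_mul, mul_zero, zero_mul,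
      add_zero, zero_add, smul_zero, smul_smul, mul_inv_cancel₀ (hq.ne_zero a i), one_smul,
      Matrix.one_fin_two]
  weight a b := by
    by_cases hb : b = i
    · subst hb
      ext u v
      fin_cases u <;> fin_cases v <;>
        simp [h.weight a, h.comm a, smul_comm (q a b) (_ : K)]
    · ext u v
      fin_cases u <;> fin_cases v <;>
        simp [h.weight a, hb, smul_comm (q a i) (q a b)]
  serre a b hab := by
    have hX (j : ι) : !![x j, if j = i then μ • k i else 0; 0, x j] =
        Matrix.scalarAlgHom (Fin 2) K (x j) + !![0, if j = i then μ • k i else 0; 0, 0] := by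
      ext u v
      fin_cases u <;> fin_cases v <;> simp
    have hw (a b : ι) : !![0, if a = i then μ • k i else 0; 0, 0] *
        Matrix.scalarAlgHom (Fin 2) K (x b) = q a b • (Matrix.scalarAlgHom (Fin 2) K (x b) *
          !![0, if a = i then μ • k i else 0; 0, 0]) := by
      by_cases ha : a = i
      · subst ha
        ext u v
        fin_cases u <;> fin_cases v <;>
          simp [Matrix.mul_apply, h.weight a b, smul_comm μ]
      · ext u v
        fin_cases u <;> fin_cases v <;> simp [Matrix.mul_apply, ha]
    rw [hX, hX, qSerre_add (hq.ne_zero a b) (hq.ne_zero a a) (hq.one_le a b) (hq.le_three a b)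
      (hq.mul_eq_one a b hab) (hw a a) (hw a b) (hw b a), ← map_qSerre, h.serre a b hab, map_zero,
      zero_add]
    have h0 : (!![0, 0; 0, 0] : Matrix (Fin 2) (Fin 2) A) = 0 := by
      ext u v
      fin_cases u <;> fin_cases v <;> rfl
    by_cases ha : a = i
    · rw [if_neg (fun hb => hab (ha.trans hb.symm) : ¬ b = i), h0, qSerre_zero_right]
    · rw [if_neg ha, h0, qSerre_zero_left _ _ _ (hq.one_le a b)]

end QBorel

end QBorel

section Presentation

variable {K : Type} [Field K] {ι : Type} {A C : Type} [Ring A] [Algebra K A] [Ring C] [Algebra K C]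
variable {m : ι → ι → ℕ} {q : ι → ι → K} {x k l : ι → A}

namespace QBorelPresentation

@[elab_as_elim]
theorem induction (h : QBorelPresentation m q x k l) {P : A → Prop} (hx : ∀ i, P (x i))
    (hk : ∀ i, P (k i)) (hl : ∀ i, P (l i)) (hs : ∀ c : K, P (algebraMap K A c))
    (hadd : ∀ a b, P a → P b → P (a + b)) (hmul : ∀ a b, P a → P b → P (a * b)) (a : A) : P a := by
  have ha : a ∈ Algebra.adjoin K (Set.range x ∪ Set.range k ∪ Set.range l) := by
    rw [h.adjoin_eq_top]; trivial
  induction ha using Algebra.adjoin_induction with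
  | mem a ha =>
    rcases ha with (⟨i, rfl⟩ | ⟨i, rfl⟩) | ⟨i, rfl⟩
    exacts [hx i, hk i, hl i]
  | algebraMap c => exact hs c
  | add a b _ _ ha hb => exact hadd a b ha hb
  | mul a b _ _ ha hb => exact hmul a b ha hb

theorem algHom_ext (h : QBorelPresentation m q x k l) {φ ψ : A →ₐ[K] C}
    (hx : ∀ i, φ (x i) = ψ (x i)) (hk : ∀ i, φ (k i) = ψ (k i)) (hl : ∀ i, φ (l i) = ψ (l i)) :
    φ = ψ := by
  ext a
  exact h.induction hx hk hl (fun c => by simp) (fun a b ha hb => by simp [ha, hb])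
    (fun a b ha hb => by simp [ha, hb]) a

theorem exists_comul (h : QBorelPresentation m q x k l) (hq : SerreDatum m q) :
    ∃ Δ : A →ₐ[K] A ⊗[K] A, (∀ i, Δ (x i) = x i ⊗ₜ 1 + k i ⊗ₜ x i) ∧
      (∀ i, Δ (k i) = k i ⊗ₜ k i) ∧ ∀ i, Δ (l i) = l i ⊗ₜ l i :=
  h.lift _ _ _ _ (h.toQBorel.tmul hq)

theorem exists_comul_rev (h : QBorelPresentation m q x k l) (hq : SerreDatum m q) :
    ∃ Δ : A →ₐ[K] A ⊗[K] A, (∀ i, Δ (x i) = 1 ⊗ₜ x i + x i ⊗ₜ k i) ∧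
      (∀ i, Δ (k i) = k i ⊗ₜ k i) ∧ ∀ i, Δ (l i) = l i ⊗ₜ l i :=
  h.lift _ _ _ _ (h.toQBorel.tmul_rev hq)

theorem exists_counit (h : QBorelPresentation m q x k l) :
    ∃ ε : A →ₐ[K] K, (∀ i, ε (x i) = 0) ∧ (∀ i, ε (k i) = 1) ∧ ∀ i, ε (l i) = 1 :=
  h.lift _ _ _ _ QBorel.scalar

theorem exists_antipode (h : QBorelPresentation m q x k l) (hq : SerreDatum m q) :
    ∃ S : A →ₗ[K] A, S 1 = 1 ∧ (∀ a b, S (a * b) = S b * S a) ∧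
      (∀ i, S (x i) = -(l i * x i)) ∧ (∀ i, S (k i) = l i) ∧ ∀ i, S (l i) = k i := by
  obtain ⟨φ, hx, hk, hl⟩ := h.lift _ _ _ _ (h.toQBorel.op_left hq)
  refine ⟨(MulOpposite.opLinearEquiv K).symm.toLinearMap ∘ₗ φ.toLinearMap, ?_, ?_, ?_, ?_, ?_⟩ <;>
    simp [hx, hk, hl]

theorem exists_antipode_rev (h : QBorelPresentation m q x k l) (hq : SerreDatum m q) :
    ∃ S : A →ₗ[K] A, S 1 = 1 ∧ (∀ a b, S (a * b) = S b * S a) ∧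
      (∀ i, S (x i) = -(x i * l i)) ∧ (∀ i, S (k i) = l i) ∧ ∀ i, S (l i) = k i := by
  obtain ⟨φ, hx, hk, hl⟩ := h.lift _ _ _ _ (h.toQBorel.op_right hq)
  refine ⟨(MulOpposite.opLinearEquiv K).symm.toLinearMap ∘ₗ φ.toLinearMap, ?_, ?_, ?_, ?_, ?_⟩ <;>
    simp [hx, hk, hl]

theorem exists_twist (h : QBorelPresentation m q x k l) {t : ι → K} (ht : ∀ i, t i ≠ 0) :
    ∃ T : A →ₐ[K] A, (∀ i, T (x i) = x i) ∧ (∀ i, T (k i) = t i • k i) ∧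
      ∀ i, T (l i) = (t i)⁻¹ • l i :=
  h.lift _ _ _ _ (h.toQBorel.twist ht)

theorem exists_skewDerivation [DecidableEq ι] (h : QBorelPresentation m q x k l)
    (hq : SerreDatum m q) (i : ι) (μ : K) {T : A →ₐ[K] A} (hTx : ∀ j, T (x j) = x j)
    (hTk : ∀ j, T (k j) = q j i • k j) (hTl : ∀ j, T (l j) = (q j i)⁻¹ • l j) :
    ∃ D : Module.End K A, (∀ a b, D (a * b) = D a * b + T a * D b) ∧
      (∀ j, D (x j) = if j = i then μ • k i else 0) ∧ (∀ j, D (k j) = 0) ∧ ∀ j, D (l j) = 0 := by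
  obtain ⟨φ, hx, hk, hl⟩ := h.lift _ _ _ _ (h.toQBorel.matrix hq i μ)
  have hφ (a : A) : φ a 0 0 = T a ∧ φ a 1 0 = 0 ∧ φ a 1 1 = a := by
    refine h.induction ?_ ?_ ?_ ?_ ?_ ?_ a
    · simp [hx, hTx]
    · simp [hk, hTk]
    · simp [hl, hTl]
    · intro c; simp [Matrix.algebraMap_matrix_apply]
    · rintro a b ⟨h1, h2, h3⟩ ⟨h4, h5, h6⟩
      simp [h1, h2, h3, h4, h5, h6]
    · rintro a b ⟨h1, h2, h3⟩ ⟨h4, h5, h6⟩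
      simp [Matrix.mul_apply, h1, h2, h3, h4, h5, h6]
  refine ⟨⟨⟨fun a => φ a 0 1, fun a b => by simp⟩, fun c a => by simp⟩, ?_, ?_, ?_, ?_⟩
  · intro a b
    simp [Matrix.mul_apply, hφ, add_comm]
  · intro j; simp [hx]
  · intro j; simp [hk]
  · intro j; simp [hl]

end QBorelPresentation

/-- The left translation operators by the functionals dual to the generators:
automorphisms `T i` with inverses `T' i`, and `T i`-skew derivations `D i`. -/
structure QTranslations [DecidableEq ι] (c : ι → ι → K) (μ : ι → K) (x k l : ι → A)
    (T T' : ι → A →ₐ[K] A) (D : ι → Module.End K A) : Prop where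
  T_x : ∀ i j, T i (x j) = x j
  T_k : ∀ i j, T i (k j) = c i j • k j
  T_l : ∀ i j, T i (l j) = (c i j)⁻¹ • l j
  T'_x : ∀ i j, T' i (x j) = x j
  T'_k : ∀ i j, T' i (k j) = (c i j)⁻¹ • k j
  T'_l : ∀ i j, T' i (l j) = c i j • l j
  D_mul : ∀ i a b, D i (a * b) = D i a * b + T i a * D i b
  D_x : ∀ i j, D i (x j) = if j = i then μ i • k i else 0
  D_k : ∀ i j, D i (k j) = 0
  D_l : ∀ i j, D i (l j) = 0

theorem QBorelPresentation.exists_translations [DecidableEq ι] {c : ι → ι → K}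
    (h : QBorelPresentation m (fun i j => c j i) x k l) (hc : SerreDatum m c) (μ : ι → K) :
    ∃ T T' D, QTranslations c μ x k l T T' D := by
  choose T hTx hTk hTl using fun i => h.exists_twist (t := c i) (hc.ne_zero i)
  choose T' hTx' hTk' hTl' using fun i =>
    h.exists_twist (t := fun j => (c i j)⁻¹) (fun j => inv_ne_zero (hc.ne_zero i j))
  choose D hD hDx hDk hDl using fun i =>
    h.exists_skewDerivation hc.transpose i (μ i) (hTx i) (hTk i) (hTl i)
  exact ⟨T, T', D, hTx, hTk, hTl, hTx', hTk', by simpa using hTl', hD, hDx, hDk, hDl⟩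

theorem qSerre_comp {V W : Type} [AddCommGroup V] [Module K V] [AddCommGroup W] [Module K W]
    (b q : K) {M : V →ₗ[K] W} {X X' : Module.End K V} {Y Y' : Module.End K W}
    (h : Y ∘ₗ M = M ∘ₗ X) (h' : Y' ∘ₗ M = M ∘ₗ X') (m : ℕ) :
    qSerre b q Y Y' m ∘ₗ M = M ∘ₗ qSerre b q X X' m := by
  induction m with
  | zero => exact h'
  | succ m ih =>
    simp only [LinearMap.ext_iff, LinearMap.comp_apply] at h ih
    ext v
    simp [qSerre, h, ih]

namespace QTranslations

variable [DecidableEq ι] {c : ι → ι → K} {μ : ι → K} {T T' : ι → A →ₐ[K] A} {D : ι → Module.End K A}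

theorem D_one (t : QTranslations c μ x k l T T' D) (i : ι) : D i 1 = 0 := by
  simpa using t.D_mul i 1 1

theorem D_algebraMap (t : QTranslations c μ x k l T T' D) (i : ι) (r : K) :
    D i (algebraMap K A r) = 0 := by
  rw [Algebra.algebraMap_eq_smul_one, map_smul, t.D_one, smul_zero]

theorem qWeight (t : QTranslations c μ x k l T T' D) (h : QBorelPresentation m q x k l)
    (hc : ∀ i j, c i j ≠ 0) : QWeight (A := Module.End K A) c D
      (fun i => (T i).toLinearMap) (fun i => (T' i).toLinearMap) where
  comm i j := by
    change ((T i).comp (T j)).toLinearMap = ((T j).comp (T i)).toLinearMap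
    congr 1
    apply h.algHom_ext <;> intro a <;> simp [t.T_x, t.T_k, t.T_l, smul_smul, mul_comm]
  mul_inv i := by
    change ((T i).comp (T' i)).toLinearMap = (AlgHom.id K A).toLinearMap
    congr 1
    apply h.algHom_ext <;> intro a <;>
      simp [t.T_x, t.T_k, t.T_l, t.T'_x, t.T'_k, t.T'_l, smul_smul, hc]
  inv_mul i := by
    change ((T' i).comp (T i)).toLinearMap = (AlgHom.id K A).toLinearMap
    congr 1
    apply h.algHom_ext <;> intro a <;>
      simp [t.T_x, t.T_k, t.T_l, t.T'_x, t.T'_k, t.T'_l, smul_smul, hc]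
  weight i j := by
    have hT (a : A) : T i (T j a) = T j (T i a) := by
      refine h.induction ?_ ?_ ?_ ?_ ?_ ?_ a
      · simp [t.T_x]
      · simp [t.T_k, smul_smul, mul_comm]
      · simp [t.T_l, smul_smul, mul_comm]
      · simp
      · intro a b ha hb; simp [ha, hb]
      · intro a b ha hb; simp [ha, hb]
    have hD (a : A) : T i (D j a) = c i j • D j (T i a) := by
      refine h.induction ?_ ?_ ?_ ?_ ?_ ?_ a
      · intro r
        by_cases hr : r = j
        · simp [t.D_x, t.T_x, hr, t.T_k, smul_comm (c i j)]
        · simp [t.D_x, t.T_x, hr]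
      · simp [t.D_k, t.T_k]
      · simp [t.D_l, t.T_l]
      · simp [t.D_algebraMap]
      · intro a b ha hb; simp [ha, hb]
      · intro a b ha hb; simp [t.D_mul, ha, hb, hT]
    ext a
    exact hD a

theorem qSerre_mul (t : QTranslations c μ x k l T T' D) (h : QBorelPresentation m q x k l)
    (hc : SerreDatum m c) {i j : ι} (hij : i ≠ j) (a b : A) :
    qSerre (c i j) (c i i) (D i) (D j) (m i j) (a * b) =
      qSerre (c i j) (c i i) (D i) (D j) (m i j) a * b +
        ((T i).toLinearMap ^ m i j * (T j).toLinearMap : Module.End K A) a *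
          qSerre (c i j) (c i i) (D i) (D j) (m i j) b := by
  let E := Module.endTensorEndAlgHom (R := K) (S := K) (A := K) (M := A) (N := A)
  have hE (f g : Module.End K A) (a b : A) : E (f ⊗ₜ g) (a ⊗ₜ b) = f a ⊗ₜ g b := rfl
  have hM (i : ι) : D i ∘ₗ LinearMap.mul' K A = LinearMap.mul' K A ∘ₗ
      E ((D i) ⊗ₜ[K] 1 + ((T i).toLinearMap : Module.End K A) ⊗ₜ[K] D i) := by
    apply TensorProduct.ext'
    intro a b
    simp [hE, t.D_mul]
  have := qSerre_comp (c i j) (c i i) (hM i) (hM j) (m i j)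
  have hS := map_qSerre (A := Module.End K A ⊗[K] Module.End K A) (B := Module.End K (A ⊗[K] A)) E
  rw [← hS, (t.qWeight h hc.ne_zero).qSerre_tmul hc hij] at this
  simpa [hE] using LinearMap.congr_fun this (a ⊗ₜ b)

theorem qBorel (t : QTranslations c μ x k l T T' D) (h : QBorelPresentation m q x k l)
    (hc : SerreDatum m c) : QBorel (A := Module.End K A) m c D
      (fun i => (T i).toLinearMap) (fun i => (T' i).toLinearMap) where
  toQWeight := t.qWeight h hc.ne_zero
  serre i j hij := by
    have hk (r : ℕ) (a : ι) :
        qSerre (c i j) (c i i) (D i) (D j) r (k a) = 0 := by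
      induction r with
      | zero => exact t.D_k j a
      | succ r ih => simp [qSerre, ih, t.D_k]
    have hl (r : ℕ) (a : ι) :
        qSerre (c i j) (c i i) (D i) (D j) r (l a) = 0 := by
      induction r with
      | zero => exact t.D_l j a
      | succ r ih => simp [qSerre, ih, t.D_l]
    have h1 (r : ℕ) : qSerre (c i j) (c i i) (D i) (D j) r 1 = 0 := by
      induction r with
      | zero => exact t.D_one j
      | succ r ih => simp [qSerre, ih, t.D_one]
    have hx (r : ℕ) (a : ι) :
        qSerre (c i j) (c i i) (D i) (D j) (r + 1) (x a) = 0 := by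
      induction r with
      | zero => 
        rw [qSerre, qSerre]
        simp [t.D_x]
        split_ifs <;> simp [t.D_k]
      | succ r ih =>
        rw [qSerre]
        simp [ih, t.D_x]
        split_ifs <;> simp [hk]
    ext a
    refine h.induction ?_ ?_ ?_ ?_ ?_ ?_ a
    · intro a
      obtain ⟨r, hr⟩ := Nat.exists_eq_add_of_le' (hc.one_le i j)
      rw [hr]
      exact hx r a
    · exact hk _
    · exact hl _
    · intro r
      rw [Algebra.algebraMap_eq_smul_one, map_smul, h1, smul_zero]; rfl
    · intro a b ha hb
      rw [map_add, ha, hb]; simp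
    · intro a b ha hb
      rw [t.qSerre_mul h hc hij, ha, hb]; simp

end QTranslations

end Presentation

section Pairing

variable {K : Type} [Field K] {ι : Type} {A A' : Type} [Ring A] [Algebra K A] [Ring A']
  [Algebra K A'] {m : ι → ι → ℕ} {q : ι → ι → K} {x k l : ι → A} {y κ ν : ι → A'}

/-- A skew-dual pairing of the bialgebras `A'` and `A`. -/
structure IsSkewPairing (Δ : A →ₐ[K] A ⊗[K] A) (ε : A →ₐ[K] K) (Δ' : A' →ₐ[K] A' ⊗[K] A')
    (ε' : A' →ₐ[K] K) (p : A' →ₗ[K] A →ₗ[K] K) : Prop where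
  apply_one : ∀ f, p f 1 = ε' f
  one_apply : ∀ a, p 1 a = ε a
  apply_mul : ∀ f a b, p f (a * b) =
    LinearMap.mul' K K (TensorProduct.map (p.flip b) (p.flip a) (Δ' f))
  mul_apply : ∀ f g a, p (f * g) a =
    LinearMap.mul' K K (TensorProduct.map (p f) (p g) (Δ a))

/-- The values of a pairing on the generators of two quantum Borel algebras. -/
structure PairingValues [DecidableEq ι] (c : ι → ι → K) (μ : ι → K) (x k l : ι → A)
    (y κ ν : ι → A') (p : A' →ₗ[K] A →ₗ[K] K) : Prop where
  y_x : ∀ i j, p (y i) (x j) = if i = j then μ i else 0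
  κ_k : ∀ i j, p (κ i) (k j) = c i j
  κ_l : ∀ i j, p (κ i) (l j) = (c i j)⁻¹
  ν_k : ∀ i j, p (ν i) (k j) = (c i j)⁻¹
  ν_l : ∀ i j, p (ν i) (l j) = c i j
  y_k : ∀ i j, p (y i) (k j) = 0
  y_l : ∀ i j, p (y i) (l j) = 0
  κ_x : ∀ i j, p (κ i) (x j) = 0
  ν_x : ∀ i j, p (ν i) (x j) = 0

/-- Bialgebra structure maps with the coproduct `x ↦ x ⊗ 1 + k ⊗ x`. -/
structure IsBorelCoalg (x k l : ι → A) (Δ : A →ₐ[K] A ⊗[K] A) (ε : A →ₐ[K] K) : Prop where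
  Δ_x : ∀ i, Δ (x i) = x i ⊗ₜ 1 + k i ⊗ₜ x i
  Δ_k : ∀ i, Δ (k i) = k i ⊗ₜ k i
  Δ_l : ∀ i, Δ (l i) = l i ⊗ₜ l i
  ε_x : ∀ i, ε (x i) = 0
  ε_k : ∀ i, ε (k i) = 1
  ε_l : ∀ i, ε (l i) = 1

/-- Bialgebra structure maps with the coproduct `x ↦ 1 ⊗ x + x ⊗ k`. -/
structure IsBorelCoalgRev (x k l : ι → A) (Δ : A →ₐ[K] A ⊗[K] A) (ε : A →ₐ[K] K) : Prop where
  Δ_x : ∀ i, Δ (x i) = 1 ⊗ₜ x i + x i ⊗ₜ k i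
  Δ_k : ∀ i, Δ (k i) = k i ⊗ₜ k i
  Δ_l : ∀ i, Δ (l i) = l i ⊗ₜ l i
  ε_x : ∀ i, ε (x i) = 0
  ε_k : ∀ i, ε (k i) = 1
  ε_l : ∀ i, ε (l i) = 1

variable {Δ : A →ₐ[K] A ⊗[K] A} {ε : A →ₐ[K] K} {Δ' : A' →ₐ[K] A' ⊗[K] A'} {ε' : A' →ₐ[K] K}

theorem IsBorelCoalg.rid_map_counit (H : IsBorelCoalg x k l Δ ε)
    (h : QBorelPresentation m q x k l) (a : A) :
    TensorProduct.rid K A (TensorProduct.map LinearMap.id ε.toLinearMap (Δ a)) = a := by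
  have : ((Algebra.TensorProduct.rid K K A).toAlgHom.comp
      (Algebra.TensorProduct.map (AlgHom.id K A) ε)).comp Δ = AlgHom.id K A := by
    apply h.algHom_ext <;> intro i <;> simp [H.Δ_x, H.Δ_k, H.Δ_l, H.ε_x, H.ε_k, H.ε_l]
  exact AlgHom.congr_fun this a

namespace QTranslations

variable [DecidableEq ι] {c : ι → ι → K} {μ : ι → K} {T T' : ι → A →ₐ[K] A}
  {D : ι → Module.End K A}

theorem comul_T (t : QTranslations c μ x k l T T' D) (h : QBorelPresentation m q x k l)
    (H : IsBorelCoalg x k l Δ ε) (i : ι) (a : A) :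
    Δ (T i a) = LinearMap.lTensor A (T i).toLinearMap (Δ a) := by
  have : Δ.comp (T i) = (Algebra.TensorProduct.map (AlgHom.id K A) (T i)).comp Δ := by
    apply h.algHom_ext <;> intro j <;>
      simp [H.Δ_x, H.Δ_k, H.Δ_l, t.T_x, t.T_k, t.T_l]
  exact AlgHom.congr_fun this a

theorem comul_T' (t : QTranslations c μ x k l T T' D) (h : QBorelPresentation m q x k l)
    (H : IsBorelCoalg x k l Δ ε) (i : ι) (a : A) :
    Δ (T' i a) = LinearMap.lTensor A (T' i).toLinearMap (Δ a) := by
  have : Δ.comp (T' i) = (Algebra.TensorProduct.map (AlgHom.id K A) (T' i)).comp Δ := by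
    apply h.algHom_ext <;> intro j <;>
      simp [H.Δ_x, H.Δ_k, H.Δ_l, t.T'_x, t.T'_k, t.T'_l]
  exact AlgHom.congr_fun this a

theorem lTensor_D_mul (t : QTranslations c μ x k l T T' D) (i : ι) (X Y : A ⊗[K] A) :
    LinearMap.lTensor A (D i) (X * Y) = LinearMap.lTensor A (D i) X * Y +
      LinearMap.lTensor A (T i).toLinearMap X * LinearMap.lTensor A (D i) Y := by
  induction X with
  | zero => simp
  | add X X' hX hX' => simp only [add_mul, map_add, hX, hX']; abel
  | tmul a b =>
    induction Y with
    | zero => simp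
    | add Y Y' hY hY' => simp only [mul_add, map_add, hY, hY']; abel
    | tmul a' b' => simp [t.D_mul, TensorProduct.tmul_add]

theorem comul_D (t : QTranslations c μ x k l T T' D) (h : QBorelPresentation m q x k l)
    (H : IsBorelCoalg x k l Δ ε) (i : ι) (a : A) :
    Δ (D i a) = LinearMap.lTensor A (D i) (Δ a) := by
  refine h.induction ?_ ?_ ?_ ?_ ?_ ?_ a
  · intro j
    by_cases hj : j = i <;> simp [H.Δ_x, H.Δ_k, t.D_x, t.D_one, hj]
  · simp [H.Δ_k, t.D_k]
  · simp [H.Δ_l, t.D_l]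
  · intro r
    simp [t.D_algebraMap, Algebra.TensorProduct.algebraMap_apply, t.D_one]
  · intro a b ha hb; simp [ha, hb]
  · intro a b ha hb
    rw [t.D_mul, map_add, map_mul, map_mul, map_mul, ha, hb, t.comul_T h H, t.lTensor_D_mul]

end QTranslations

theorem exists_skewPairing [DecidableEq ι] {c : ι → ι → K}
    (h : QBorelPresentation m (fun i j => c j i) x k l) (h' : QBorelPresentation m c y κ ν)
    (hc : SerreDatum m c) (μ : ι → K) (H : IsBorelCoalg x k l Δ ε)
    (H' : IsBorelCoalgRev y κ ν Δ' ε') :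
    ∃ p, IsSkewPairing Δ ε Δ' ε' p ∧ PairingValues c μ x k l y κ ν p := by
  obtain ⟨T, T', D, t⟩ := h.exists_translations hc μ
  obtain ⟨φ, hy, hκ, hν⟩ := h'.lift _ _ _ _ (t.qBorel h hc)
  have hone (f : A') : φ f 1 = ε' f • (1 : A) := by
    refine h'.induction ?_ ?_ ?_ ?_ ?_ ?_ f
    · simp [hy, t.D_one, H'.ε_x]
    · simp [hκ, H'.ε_k]
    · simp [hν, H'.ε_l]
    · simp
    · intro f g hf hg; simp [hf, hg, add_smul]
    · intro f g hf hg; simp [hf, hg, smul_smul, mul_comm]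
  let F (a b : A) : A' ⊗[K] A' →ₗ[K] A := TensorProduct.lift
    (LinearMap.mk₂ K (fun u v => φ v a * φ u b) (by simp [mul_add]) (by simp) (by simp [add_mul])
      (by simp))
  have hF (a b : A) (u v : A') : F a b (u ⊗ₜ v) = φ v a * φ u b := rfl
  have hmul (f : A') : ∀ a b : A, φ f (a * b) = F a b (Δ' f) := by
    refine h'.induction ?_ ?_ ?_ ?_ ?_ ?_ f
    · intro i a b; simp [hy, hκ, H'.Δ_x, hF, t.D_mul]
    · intro i a b; simp [hκ, H'.Δ_k, hF]
    · intro i a b; simp [hν, H'.Δ_l, hF]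
    · intro r a b; simp [Algebra.TensorProduct.algebraMap_apply, hF]
    · intro f g hf hg a b; simp [hf, hg]
    · intro f g hf hg a b
      rw [map_mul φ, map_mul Δ', Module.End.mul_apply, hg]
      induction Δ' g with
      | zero => simp
      | add X Y hX hY => simp only [map_add, mul_add, hX, hY]
      | tmul u v =>
        rw [hF, hf]
        induction Δ' f with
        | zero => simp
        | add X Y hX hY => simp only [map_add, add_mul, hX, hY]
        | tmul u' v' => simp [hF]
  have hcomul (f : A') : ∀ a : A, Δ (φ f a) = LinearMap.lTensor A (φ f) (Δ a) := by
    refine h'.induction ?_ ?_ ?_ ?_ ?_ ?_ f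
    · intro i a; rw [hy, t.comul_D h H]
    · intro i a; rw [hκ]; exact t.comul_T h H i a
    · intro i a; rw [hν]; exact t.comul_T' h H i a
    · intro r a
      rw [AlgHom.commutes, Algebra.algebraMap_eq_smul_one, LinearMap.lTensor_smul,
        Module.End.one_eq_id, LinearMap.lTensor_id]
      simp
    · intro f g hf hg a; simp [hf, hg, LinearMap.lTensor_add]
    · intro f g hf hg a; simp [hf, hg, LinearMap.lTensor_mul]
  refine ⟨LinearMap.mk₂ K (fun f a => ε (φ f a)) (by simp) (by simp) (by simp) (by simp),
    ⟨?_, ?_, ?_, ?_⟩, ?_⟩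
  · intro f; simp [hone]
  · intro a; simp
  · intro f a b
    simp only [LinearMap.mk₂_apply, hmul]
    induction Δ' f with
    | zero => simp
    | add X Y hX hY => simp only [map_add, hX, hY]
    | tmul u v => simp [hF, mul_comm]
  · intro f g a
    have := H.rid_map_counit h (φ g a)
    rw [hcomul] at this
    simp only [LinearMap.mk₂_apply, map_mul, Module.End.mul_apply]
    rw [← this]
    induction Δ a with
    | zero => simp
    | add X Y hX hY => simp only [map_add, hX, hY]
    | tmul u v => simp [mul_comm]
  · constructor <;> intro i j <;>
      simp [hy, hκ, hν, t.D_x, t.D_k, t.D_l, t.T_x, t.T_k, t.T_l, t.T'_x, t.T'_k, t.T'_l, H.ε_x,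
        H.ε_k, H.ε_l]
    split_ifs with h1 h2 h2 <;> simp_all [H.ε_k]

theorem skewPairing_unique [DecidableEq ι] {c : ι → ι → K} {μ : ι → K} {q' : ι → ι → K}
    (h : QBorelPresentation m q x k l) (h' : QBorelPresentation m q' y κ ν)
    (H' : IsBorelCoalgRev y κ ν Δ' ε') {p p' : A' →ₗ[K] A →ₗ[K] K}
    (hp : IsSkewPairing Δ ε Δ' ε' p) (vp : PairingValues c μ x k l y κ ν p)
    (hp' : IsSkewPairing Δ ε Δ' ε' p') (vp' : PairingValues c μ x k l y κ ν p') : p = p' := by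
  have hs (f : A') (r : K) : p f (algebraMap K A r) = p' f (algebraMap K A r) := by
    simp only [Algebra.algebraMap_eq_smul_one, map_smul, hp.apply_one, hp'.apply_one]
  have hκ (i : ι) (a : A) : p (κ i) a = p' (κ i) a := by
    refine h.induction ?_ ?_ ?_ (hs _) ?_ ?_ a
    · simp [vp.κ_x, vp'.κ_x]
    · simp [vp.κ_k, vp'.κ_k]
    · simp [vp.κ_l, vp'.κ_l]
    · intro a b ha hb; simp [ha, hb]
    · intro a b ha hb; simp [hp.apply_mul, hp'.apply_mul, H'.Δ_k, ha, hb]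
  have hν (i : ι) (a : A) : p (ν i) a = p' (ν i) a := by
    refine h.induction ?_ ?_ ?_ (hs _) ?_ ?_ a
    · simp [vp.ν_x, vp'.ν_x]
    · simp [vp.ν_k, vp'.ν_k]
    · simp [vp.ν_l, vp'.ν_l]
    · intro a b ha hb; simp [ha, hb]
    · intro a b ha hb; simp [hp.apply_mul, hp'.apply_mul, H'.Δ_l, ha, hb]
  have hy (i : ι) (a : A) : p (y i) a = p' (y i) a := by
    refine h.induction ?_ ?_ ?_ (hs _) ?_ ?_ a
    · simp [vp.y_x, vp'.y_x]
    · simp [vp.y_k, vp'.y_k]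
    · simp [vp.y_l, vp'.y_l]
    · intro a b ha hb; simp [ha, hb]
    · intro a b ha hb
      simp [hp.apply_mul, hp'.apply_mul, H'.Δ_x, ha, hb, hκ, hp.one_apply, hp'.one_apply]
  ext f : 1
  refine h'.induction ?_ ?_ ?_ ?_ ?_ ?_ f
  · intro i; ext a; exact hy i a
  · intro i; ext a; exact hκ i a
  · intro i; ext a; exact hν i a
  · intro r; ext a
    simp [Algebra.algebraMap_eq_smul_one, hp.one_apply, hp'.one_apply]
  · intro f g hf hg; rw [map_add, map_add, hf, hg]
  · intro f g hf hg; ext a; rw [hp.mul_apply, hp'.mul_apply, hf, hg]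

theorem map_antipode_mul {S : A →ₗ[K] A} (hS : ∀ a b, S (a * b) = S b * S a) (X Y : A ⊗[K] A) :
    TensorProduct.map S S (X * Y) = TensorProduct.map S S Y * TensorProduct.map S S X := by
  induction X with
  | zero => simp
  | add X X' hX hX' => simp only [add_mul, mul_add, map_add, hX, hX']
  | tmul a b =>
    induction Y with
    | zero => simp
    | add Y Y' hY hY' => simp only [add_mul, mul_add, map_add, hY, hY']
    | tmul a' b' => simp [hS]

theorem QBorelPresentation.comul_antipode (h : QBorelPresentation m q x k l) {S : A →ₗ[K] A}
    (h1 : S 1 = 1) (hS : ∀ a b, S (a * b) = S b * S a)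
    (hx : ∀ i, Δ (S (x i)) = TensorProduct.comm K A A (TensorProduct.map S S (Δ (x i))))
    (hk : ∀ i, Δ (S (k i)) = TensorProduct.comm K A A (TensorProduct.map S S (Δ (k i))))
    (hl : ∀ i, Δ (S (l i)) = TensorProduct.comm K A A (TensorProduct.map S S (Δ (l i)))) (a : A) :
    Δ (S a) = TensorProduct.comm K A A (TensorProduct.map S S (Δ a)) := by
  refine h.induction hx hk hl ?_ ?_ ?_ a
  · intro r
    simp [Algebra.algebraMap_eq_smul_one, h1, Algebra.TensorProduct.one_def]
  · intro a b ha hb; simp [ha, hb]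
  · intro a b ha hb
    rw [hS, map_mul, map_mul, map_antipode_mul hS, ha, hb]
    exact (map_mul (Algebra.TensorProduct.comm K A A) _ _).symm

theorem QBorelPresentation.counit_antipode (h : QBorelPresentation m q x k l) {S : A →ₗ[K] A}
    (h1 : S 1 = 1) (hS : ∀ a b, S (a * b) = S b * S a) (hx : ∀ i, ε (S (x i)) = ε (x i))
    (hk : ∀ i, ε (S (k i)) = ε (k i)) (hl : ∀ i, ε (S (l i)) = ε (l i)) (a : A) :
    ε (S a) = ε a := by
  refine h.induction hx hk hl ?_ ?_ ?_ a
  · intro r; simp [Algebra.algebraMap_eq_smul_one, h1]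
  · intro a b ha hb; simp [ha, hb]
  · intro a b ha hb; simp [hS, ha, hb, mul_comm]

theorem skewPairing_antipode [DecidableEq ι] {c : ι → ι → K} {μ : ι → K} {q' : ι → ι → K}
    (hc : ∀ i j, c i j ≠ 0)
    (h : QBorelPresentation m q x k l) (h' : QBorelPresentation m q' y κ ν)
    (H : IsBorelCoalg x k l Δ ε) (H' : IsBorelCoalgRev y κ ν Δ' ε')
    {S : A →ₗ[K] A} (S_one : S 1 = 1) (S_mul : ∀ a b, S (a * b) = S b * S a)
    (S_x : ∀ i, S (x i) = -(l i * x i)) (S_k : ∀ i, S (k i) = l i) (S_l : ∀ i, S (l i) = k i)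
    {S' : A' →ₗ[K] A'} (S'_one : S' 1 = 1) (S'_mul : ∀ a b, S' (a * b) = S' b * S' a)
    (S'_x : ∀ i, S' (y i) = -(y i * ν i)) (S'_k : ∀ i, S' (κ i) = ν i)
    (S'_l : ∀ i, S' (ν i) = κ i) {p : A' →ₗ[K] A →ₗ[K] K}
    (hp : IsSkewPairing Δ ε Δ' ε' p) (vp : PairingValues c μ x k l y κ ν p) (f : A') (a : A) :
    p (S' f) (S a) = p f a := by
  have hε := h.counit_antipode (ε := ε) S_one S_mul (by simp [S_x, H.ε_x])
    (by simp [S_k, H.ε_k, H.ε_l]) (by simp [S_l, H.ε_k, H.ε_l])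
  have hε' := h'.counit_antipode (ε := ε') S'_one S'_mul (by simp [S'_x, H'.ε_x])
    (by simp [S'_k, H'.ε_k, H'.ε_l]) (by simp [S'_l, H'.ε_k, H'.ε_l])
  have hΔ := h.comul_antipode (Δ := Δ) S_one S_mul
    (fun i => by
      simp [S_x, S_one, S_k, H.Δ_x, H.Δ_l, h.inv_mul, mul_add, TensorProduct.tmul_neg,
        TensorProduct.neg_tmul, add_comm])
    (by simp [S_k, H.Δ_k, H.Δ_l]) (by simp [S_l, H.Δ_k, H.Δ_l])
  have hΔ' := h'.comul_antipode (Δ := Δ') S'_one S'_mul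
    (fun i => by
      simp [S'_x, S'_one, S'_k, H'.Δ_x, H'.Δ_l, h'.mul_inv, add_mul, TensorProduct.tmul_neg,
        TensorProduct.neg_tmul, add_comm])
    (by simp [S'_k, H'.Δ_k, H'.Δ_l]) (by simp [S'_l, H'.Δ_k, H'.Δ_l])
  have hpS : IsSkewPairing Δ ε Δ' ε' (p.compl₁₂ S' S) := by
    refine ⟨?_, ?_, ?_, ?_⟩
    · intro f; simp [S_one, hp.apply_one, hε']
    · intro a; simp [S'_one, hp.one_apply, hε]
    · intro f a b
      simp only [LinearMap.compl₁₂_apply, S_mul, hp.apply_mul, hΔ']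
      induction Δ' f with
      | zero => simp
      | add X Y hX hY => simp only [map_add, hX, hY]
      | tmul u v => simp [mul_comm]
    · intro f g a
      simp only [LinearMap.compl₁₂_apply, S'_mul, hp.mul_apply, hΔ]
      induction Δ a with
      | zero => simp
      | add X Y hX hY => simp only [map_add, hX, hY]
      | tmul u v => simp [mul_comm]
  have hlx (i j : ι) : p (y i) (l j * x j) = if i = j then μ i * (c i j)⁻¹ else 0 := by
    simp [hp.apply_mul, H'.Δ_x, vp.y_x, vp.κ_l, vp.y_l]
  have vpS : PairingValues c μ x k l y κ ν (p.compl₁₂ S' S) := by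
    constructor <;> intro i j
    · simp [S_x, S'_x, hp.mul_apply, H.Δ_x, H.Δ_l, mul_add, h.inv_mul, hlx, vp.ν_l, hp.apply_one,
        H'.ε_x]
      split_ifs <;> simp [hc]
    · simp [S_k, S'_k, vp.ν_l]
    · simp [S_l, S'_k, vp.ν_k]
    · simp [S_k, S'_l, vp.κ_l]
    · simp [S_l, S'_l, vp.κ_k]
    · simp [S_k, S'_x, hp.mul_apply, H.Δ_l, vp.y_l]
    · simp [S_l, S'_x, hp.mul_apply, H.Δ_k, vp.y_k]
    · simp [S_x, S'_k, hp.apply_mul, H'.Δ_l, vp.ν_x]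
    · simp [S_x, S'_l, hp.apply_mul, H'.Δ_k, vp.κ_x]
  have := skewPairing_unique h h' H' hpS vpS hp vp
  exact LinearMap.congr_fun (LinearMap.congr_fun this f) a

end Pairing

section SerreRelations

variable {K : Type} [Field K] {A : Type} [Ring A] [Algebra K A]

theorem qSerre_two (b q : K) (x y : A) : qSerre b q x y 2 =
    x ^ 2 * y - (b + b * q) • (x * y * x) + (b ^ 2 * q) • (y * x ^ 2) := by
  simp only [qSerre, mul_sub, sub_mul, smul_sub, smul_mul_assoc, mul_smul_comm, smul_smul,
    ← mul_assoc, pow_two]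
  module

theorem qSerre_three (b q : K) (x y : A) : qSerre b q x y 3 =
    x ^ 3 * y - (b * (1 + q + q ^ 2)) • (x ^ 2 * y * x)
      + (b ^ 2 * q * (1 + q + q ^ 2)) • (x * y * x ^ 2) - (b ^ 3 * q ^ 3) • (y * x ^ 3) := by
  simp only [qSerre, mul_sub, sub_mul, smul_sub, smul_mul_assoc, mul_smul_comm, smul_smul,
    ← mul_assoc, pow_succ, pow_zero, one_mul]
  module

variable {b q a₁ a₂ a₃ : K} (x y : A)

theorem serre_two_iff (h₁ : b + b * q = a₁) (h₂ : b ^ 2 * q = a₂) :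
    x ^ 2 * y - a₁ • (x * y * x) + a₂ • (y * x ^ 2) = 0 ↔ qSerre b q x y 2 = 0 := by
  rw [qSerre_two, h₁, h₂]

theorem serre_two_op_iff (h₁ : a₂ * (b + b * q) = a₁) (h₂ : a₂ * (b ^ 2 * q) = 1) :
    y * x ^ 2 - a₁ • (x * y * x) + a₂ • (x ^ 2 * y) = 0 ↔ qSerre b q x y 2 = 0 := by
  have h : y * x ^ 2 - a₁ • (x * y * x) + a₂ • (x ^ 2 * y) = a₂ • qSerre b q x y 2 := by
    rw [qSerre_two, smul_add, smul_sub, smul_smul, smul_smul, h₁, h₂]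
    module
  rw [h, smul_eq_zero_iff_right (left_ne_zero_of_mul_eq_one h₂)]

theorem serre_three_iff (h₁ : b * (1 + q + q ^ 2) = a₁) (h₂ : b ^ 2 * q * (1 + q + q ^ 2) = a₂)
    (h₃ : b ^ 3 * q ^ 3 = a₃) :
    x ^ 3 * y - a₁ • (x ^ 2 * y * x) + a₂ • (x * y * x ^ 2) - a₃ • (y * x ^ 3) = 0 ↔
      qSerre b q x y 3 = 0 := by
  rw [qSerre_three, h₁, h₂, h₃]

theorem serre_three_op_iff (h₁ : a₃ * (b ^ 2 * q * (1 + q + q ^ 2)) = a₁)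
    (h₂ : a₃ * (b * (1 + q + q ^ 2)) = a₂) (h₃ : a₃ * (b ^ 3 * q ^ 3) = 1) :
    y * x ^ 3 - a₁ • (x * y * x ^ 2) + a₂ • (x ^ 2 * y * x) - a₃ • (x ^ 3 * y) = 0 ↔
      qSerre b q x y 3 = 0 := by
  have h : y * x ^ 3 - a₁ • (x * y * x ^ 2) + a₂ • (x ^ 2 * y * x) - a₃ • (x ^ 3 * y) =
      -(a₃ • qSerre b q x y 3) := by
    rw [qSerre_three, smul_sub, smul_add, smul_sub, smul_smul, smul_smul, smul_smul, h₁, h₂, h₃]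
    module
  rw [h, neg_eq_zero, smul_eq_zero_iff_right (left_ne_zero_of_mul_eq_one h₃)]

theorem commute_iff_qSerre : x * y - y * x = 0 ↔ qSerre (1 : K) q x y 1 = 0 := by
  simp [qSerre]

theorem conj_eq_smul_iff {k l x : A} (hkl : k * l = 1) (hlk : l * k = 1) (c : K) :
    k * x * l = c • x ↔ k * x = c • (x * k) := by
  constructor <;> intro h
  · rw [← smul_mul_assoc, ← h, mul_assoc, hlk, mul_one]
  · rw [h, smul_mul_assoc, mul_assoc, hkl, mul_one]

end SerreRelations

section TypeC

theorem qr_ne_zero : qr ≠ 0 := by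
  simp [qr, MvPolynomial.X_ne_zero]

theorem qs_ne_zero : qs ≠ 0 := by
  simp [qs, MvPolynomial.X_ne_zero]

/-- The degrees of the Serre relations in type `C`. -/
def serreDeg (n : ℕ) (i j : Fin (n + 1)) : ℕ :=
  if (i : ℕ) + 1 < j ∨ (j : ℕ) + 1 < i then 1 else if (i : ℕ) + 1 = n ∧ (j : ℕ) = n then 3 else 2

variable {n : ℕ} {i j : Fin (n + 1)}

theorem cstC_self (h : (i : ℕ) < n) : cstC n i i = qr / qs := by
  simp [cstC, ipaC, h, div_eq_mul_inv]

theorem cstC_last : cstC n (Fin.last n) (Fin.last n) = qr ^ 2 / qs ^ 2 := by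
  simp [cstC, div_eq_mul_inv]

theorem cstC_far (h : (i : ℕ) + 1 < j ∨ (j : ℕ) + 1 < i) : cstC n i j = 1 := by
  have hi := i.isLt
  have hj := j.isLt
  unfold cstC ipaC
  split_ifs <;> first | omega | simp

theorem cstC_succ (hij : (j : ℕ) = i + 1) (h : (i : ℕ) + 1 < n) : cstC n i j = qr⁻¹ := by
  unfold cstC ipaC
  split_ifs <;> first | omega | simp

theorem cstC_pred (hij : (j : ℕ) = i + 1) (h : (i : ℕ) + 1 < n) : cstC n j i = qs := by
  unfold cstC ipaC
  split_ifs <;> first | omega | simp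

theorem cstC_succ_last (h : (i : ℕ) + 1 = n) : cstC n i (Fin.last n) = (qr ^ 2)⁻¹ := by
  have hi : (i : ℕ) < n := by omega
  simp [cstC, ipaC, hi, h, hi.ne']

theorem cstC_last_pred (h : (i : ℕ) + 1 = n) : cstC n (Fin.last n) i = qs ^ 2 := by
  have hi : (i : ℕ) < n := by omega
  simp [cstC, ipaC, hi, h, hi.ne]

theorem cstC_of_lt (h : (j : ℕ) < n) :
    qr ^ ipaC n j i * qs ^ ipaC n ((j : ℕ) + 1) i = cstC n i j := by
  simp [cstC, h]

theorem cstC_last_of_lt (h : (i : ℕ) < n) : qr ^ (2 * ipaC n n i) = cstC n i (Fin.last n) := by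
  simp [cstC, h]

/-- The possible relative positions of two distinct vertices of the Dynkin diagram. -/
theorem typeC_cases {P : Fin (n + 1) → Fin (n + 1) → Prop}
    (far : ∀ i j : Fin (n + 1), (i : ℕ) + 1 < j ∨ (j : ℕ) + 1 < i → P i j)
    (succ : ∀ i j : Fin (n + 1), (j : ℕ) = (i : ℕ) + 1 → (i : ℕ) + 1 < n → P i j)
    (pred : ∀ i j : Fin (n + 1), (j : ℕ) = (i : ℕ) + 1 → (i : ℕ) + 1 < n → P j i)
    (succ_last : ∀ i : Fin (n + 1), (i : ℕ) + 1 = n → P i (Fin.last n))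
    (last_pred : ∀ i : Fin (n + 1), (i : ℕ) + 1 = n → P (Fin.last n) i)
    (hij : i ≠ j) : P i j := by
  have hi := i.isLt
  have hj := j.isLt
  rw [Ne, Fin.ext_iff] at hij
  by_cases h : (i : ℕ) + 1 < j ∨ (j : ℕ) + 1 < i
  · exact far i j h
  obtain h | h : (j : ℕ) = i + 1 ∨ (i : ℕ) = j + 1 := by omega
  · obtain h' | h' : (i : ℕ) + 1 < n ∨ (i : ℕ) + 1 = n := by omega
    · exact succ i j h h'
    · obtain rfl : j = Fin.last n := Fin.ext (by simp [h, h'])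
      exact succ_last i h'
  · obtain h' | h' : (j : ℕ) + 1 < n ∨ (j : ℕ) + 1 = n := by omega
    · exact pred j i h h'
    · obtain rfl : i = Fin.last n := Fin.ext (by simp [h, h'])
      exact last_pred j h'

theorem serreDeg_far (h : (i : ℕ) + 1 < j ∨ (j : ℕ) + 1 < i) : serreDeg n i j = 1 := by
  simp [serreDeg, h]

theorem serreDeg_succ (hij : (j : ℕ) = i + 1) (h : (i : ℕ) + 1 < n) : serreDeg n i j = 2 := by
  unfold serreDeg
  split_ifs <;> omega

theorem serreDeg_pred (hij : (j : ℕ) = i + 1) : serreDeg n j i = 2 := by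
  unfold serreDeg
  split_ifs <;> omega

theorem serreDeg_succ_last (h : (i : ℕ) + 1 = n) : serreDeg n i (Fin.last n) = 3 := by
  simp [serreDeg, h]

theorem serreDatum_cstC (n : ℕ) : SerreDatum (serreDeg n) (cstC n) := by
  have hr := qr_ne_zero
  have hs := qs_ne_zero
  refine ⟨?_, ?_, ?_, fun i j hij => ?_⟩
  · intro i j
    unfold cstC
    split_ifs <;> simp [hr, hs, zpow_ne_zero]
  · intro i j; unfold serreDeg; split_ifs <;> simp
  · intro i j; unfold serreDeg; split_ifs <;> simp
  · refine typeC_cases (P := fun i j => cstC n i j * cstC n j i *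
      cstC n i i ^ (serreDeg n i j - 1) = 1) ?_ ?_ ?_ ?_ ?_ hij
    · intro i j h
      simp [cstC_far h, cstC_far h.symm, serreDeg_far h]
    · intro i j hij h
      rw [cstC_succ hij h, cstC_pred hij h, cstC_self (by omega), serreDeg_succ hij h]
      simp only [Nat.reduceSub, pow_one]
      field_simp
    · intro i j hij h
      rw [cstC_succ hij h, cstC_pred hij h, cstC_self (by omega), serreDeg_pred hij]
      simp only [Nat.reduceSub, pow_one]
      field_simp
    · intro i h
      rw [cstC_succ_last h, cstC_last_pred h, cstC_self (by omega), serreDeg_succ_last h]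
      simp only [Nat.reduceSub]
      field_simp
    · intro i h
      rw [cstC_succ_last h, cstC_last_pred h, cstC_last, serreDeg_pred (by simp [h])]
      simp only [Nat.reduceSub, pow_one]
      field_simp

end TypeC

section TypeCPresentation

theorem qBorel_typeC_iff {K : Type} [Field K] {n : ℕ} {c : Fin (n + 1) → Fin (n + 1) → K}
    {A : Type} [Ring A] [Algebra K A] {x k l : Fin (n + 1) → A} :
    QBorel (serreDeg n) c x k l ↔ QWeight c x k l ∧
      (∀ i j : Fin (n + 1), (i : ℕ) + 1 < j ∨ (j : ℕ) + 1 < i →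
        qSerre (c i j) (c i i) (x i) (x j) 1 = 0) ∧
      (∀ i j : Fin (n + 1), (j : ℕ) = (i : ℕ) + 1 → (i : ℕ) + 1 < n →
        qSerre (c i j) (c i i) (x i) (x j) 2 = 0 ∧ qSerre (c j i) (c j j) (x j) (x i) 2 = 0) ∧
      ∀ i : Fin (n + 1), (i : ℕ) + 1 = n →
        qSerre (c i (Fin.last n)) (c i i) (x i) (x (Fin.last n)) 3 = 0 ∧
        qSerre (c (Fin.last n) i) (c (Fin.last n) (Fin.last n)) (x (Fin.last n)) (x i) 2 = 0 := by
  constructor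
  · intro H
    refine ⟨H.toQWeight, fun i j hij => ?_, fun i j hij hi => ⟨?_, ?_⟩, fun i hi => ⟨?_, ?_⟩⟩
    · rw [← serreDeg_far hij]
      exact H.serre i j (by rintro rfl; omega)
    · rw [← serreDeg_succ hij hi]
      exact H.serre i j (by rintro rfl; omega)
    · rw [← serreDeg_pred hij]
      exact H.serre j i (by rintro rfl; omega)
    · rw [← serreDeg_succ_last hi]
      exact H.serre i _ (by rintro rfl; simp at hi)
    · rw [← serreDeg_pred (i := i) (j := Fin.last n) (by simp [hi])]
      exact H.serre _ i (by rintro rfl; simp at hi)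
  · rintro ⟨h, far, near, last⟩
    refine ⟨h, fun i j hij => ?_⟩
    refine typeC_cases (P := fun i j => qSerre (c i j) (c i i) (x i) (x j) (serreDeg n i j) = 0)
      ?_ ?_ ?_ ?_ ?_ hij
    · intro i j hij
      rw [serreDeg_far hij]
      exact far i j hij
    · intro i j hij hi
      rw [serreDeg_succ hij hi]
      exact (near i j hij hi).1
    · intro i j hij hi
      rw [serreDeg_pred hij]
      exact (near i j hij hi).2
    · intro i hi
      rw [serreDeg_succ_last hi]
      exact (last i hi).1
    · intro i hi
      rw [serreDeg_pred (by simp [hi])]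
      exact (last i hi).2

/-- The map on generators with prescribed values on the three families. -/
def GenE.elim {N : ℕ} {C : Type} (x k l : Fin N → C) : GenE N → C
  | .e i => x i
  | .w i => k i
  | .winv i => l i

/-- The map on generators with prescribed values on the three families. -/
def GenF.elim {N : ℕ} {C : Type} (x k l : Fin N → C) : GenF N → C
  | .f i => x i
  | .wp i => k i
  | .wpinv i => l i

variable {n : ℕ} {C : Type} [Ring C] [Algebra KK C]

theorem cstC_last_zpow (n : ℕ) : qr ^ 2 * qs ^ (-2 : ℤ) = cstC n (Fin.last n) (Fin.last n) := by
  simp [cstC]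

theorem cstC_of_lt_rev {i j : Fin (n + 1)} (hj : (j : ℕ) < n) :
    qs ^ (-(ipaC n j i)) * qr ^ (-(ipaC n ((j : ℕ) + 1) i)) = cstC n j i := by
  have hi := i.isLt
  unfold cstC ipaC
  split_ifs <;> first | omega | simp [mul_comm]

theorem cstC_last_of_lt_rev {i : Fin (n + 1)} (hi : (i : ℕ) < n) :
    qs ^ (-(2 * ipaC n n i)) = cstC n (Fin.last n) i := by
  unfold cstC ipaC
  simp only [Fin.val_last]
  split_ifs <;> first | omega | simp

theorem cstC_last_rev (n : ℕ) :
    qs ^ (-2 : ℤ) * qr ^ 2 = cstC n (Fin.last n) (Fin.last n) := by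
  rw [mul_comm, cstC_last_zpow]

theorem qBorel_iff_relCE {x k l : Fin (n + 1) → C} :
    QBorel (serreDeg n) (fun i j => cstC n j i) x k l ↔ ∀ u v, RelCE n u v →
      FreeAlgebra.lift KK (GenE.elim x k l) u =
      FreeAlgebra.lift KK (GenE.elim x k l) v := by
  have hr := qr_ne_zero
  have hs := qs_ne_zero
  have serre_succ (i j : Fin (n + 1)) (hij : (j : ℕ) = (i : ℕ) + 1) (hi : (i : ℕ) + 1 < n) :
      x i ^ 2 * x j - (qr + qs) • (x i * x j * x i) + (qr * qs) • (x j * x i ^ 2) = 0 ↔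
        qSerre (cstC n j i) (cstC n i i) (x i) (x j) 2 = 0 := by
    apply serre_two_iff <;> rw [cstC_pred hij hi, cstC_self (by omega)] <;> field_simp
    ring
  have serre_pred (i j : Fin (n + 1)) (hij : (j : ℕ) = (i : ℕ) + 1) (hi : (i : ℕ) + 1 < n) :
      x j ^ 2 * x i - (qr⁻¹ + qs⁻¹) • (x j * x i * x j) + (qr * qs)⁻¹ • (x i * x j ^ 2) = 0 ↔
        qSerre (cstC n i j) (cstC n j j) (x j) (x i) 2 = 0 := by
    apply serre_two_iff <;> rw [cstC_succ hij hi, cstC_self (by omega)] <;> field_simp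
  have serre_succ_last (i : Fin (n + 1)) (hi : (i : ℕ) + 1 = n) :
      x i ^ 3 * x (Fin.last n)
        - (qr ^ 2 + qr * qs + qs ^ 2) • (x i ^ 2 * x (Fin.last n) * x i)
        + (qr * qs * (qr ^ 2 + qr * qs + qs ^ 2)) • (x i * x (Fin.last n) * x i ^ 2)
        - (qr * qs) ^ 3 • (x (Fin.last n) * x i ^ 3) = 0 ↔
        qSerre (cstC n (Fin.last n) i) (cstC n i i) (x i) (x (Fin.last n)) 3 = 0 := by
    apply serre_three_iff <;> rw [cstC_last_pred hi, cstC_self (by omega)] <;> field_simp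
    all_goals ring
  have serre_last_pred (i : Fin (n + 1)) (hi : (i : ℕ) + 1 = n) :
      x (Fin.last n) ^ 2 * x i - ((riC n qr n)⁻¹ + (riC n qs n)⁻¹) •
        (x (Fin.last n) * x i * x (Fin.last n))
        + (riC n qr n * riC n qs n)⁻¹ • (x i * x (Fin.last n) ^ 2) = 0 ↔
        qSerre (cstC n i (Fin.last n)) (cstC n (Fin.last n) (Fin.last n)) (x (Fin.last n)) (x i)
          2 = 0 := by
    apply serre_two_iff <;>
      simp only [cstC_succ_last hi, cstC_last, riC, lt_irrefl, if_false] <;> field_simp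
  have far_iff (i j : Fin (n + 1)) (hij : (i : ℕ) + 1 < j ∨ (j : ℕ) + 1 < i) :
      x i * x j - x j * x i = 0 ↔ qSerre (cstC n j i) (cstC n i i) (x i) (x j) 1 = 0 := by
    rw [cstC_far hij.symm, commute_iff_qSerre (K := KK)]
  constructor
  · intro h u v huv
    obtain ⟨-, far, near, last⟩ := qBorel_typeC_iff.1 h
    induction huv with
    | comm g g' hg hg' =>
      simp only [map_mul, FreeAlgebra.lift_ι_apply]
      cases g <;> cases g' <;> first
        | exact hg.elim
        | exact hg'.elim
        | simp only [GenE.elim, h.comm, h.mul_inv_comm, h.inv_comm]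
    | winv_r i => simp [GenE.elim, h.mul_inv]
    | winv_l i => simp [GenE.elim, h.inv_mul]
    | c2we i j hj =>
      simp only [map_mul, map_smul, FreeAlgebra.lift_ι_apply, GenE.elim, cstC_of_lt hj]
      exact (conj_eq_smul_iff (h.mul_inv j) (h.inv_mul j) _).2 (h.weight j i)
    | c2wne j hj =>
      simp only [map_mul, map_smul, FreeAlgebra.lift_ι_apply, GenE.elim, cstC_last_of_lt hj]
      exact (conj_eq_smul_iff (h.mul_inv _) (h.inv_mul _) _).2 (h.weight _ j)
    | c2wnen =>
      simp only [map_mul, map_smul, FreeAlgebra.lift_ι_apply, GenE.elim, cstC_last_zpow n]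
      exact (conj_eq_smul_iff (h.mul_inv _) (h.inv_mul _) _).2 (h.weight _ _)
    | c5e i j hij => simpa [GenE.elim] using (far_iff i j hij).2 (far i j hij)
    | c6a i j hij hi => simpa [GenE.elim] using (serre_succ i j hij hi).2 (near i j hij hi).1
    | c6b i j hij hi => simpa [GenE.elim] using (serre_pred i j hij hi).2 (near i j hij hi).2
    | c6c i hi => simpa [GenE.elim] using (serre_succ_last i hi).2 (last i hi).1
    | c6d i hi => simpa [GenE.elim] using (serre_last_pred i hi).2 (last i hi).2
  · intro h
    have mul_inv (i) : k i * l i = 1 := by simpa [GenE.elim] using h _ _ (.winv_r i)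
    have inv_mul (i) : l i * k i = 1 := by simpa [GenE.elim] using h _ _ (.winv_l i)
    refine qBorel_typeC_iff.2 ⟨⟨fun i j => ?_, mul_inv, inv_mul, fun i j => ?_⟩,
      fun i j hij => (far_iff i j hij).1 ?_,
      fun i j hij hi => ⟨(serre_succ i j hij hi).1 ?_, (serre_pred i j hij hi).1 ?_⟩,
      fun i hi => ⟨(serre_succ_last i hi).1 ?_, (serre_last_pred i hi).1 ?_⟩⟩
    · simpa [GenE.elim] using h _ _ (.comm (.w i) (.w j) trivial trivial)
    · refine (conj_eq_smul_iff (mul_inv i) (inv_mul i) _).1 ?_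
      induction i using Fin.lastCases with
      | cast i =>
        have := h _ _ (.c2we j i.castSucc i.isLt)
        rw [cstC_of_lt (j := i.castSucc) i.isLt] at this
        simpa [GenE.elim] using this
      | last =>
        induction j using Fin.lastCases with
        | cast j =>
          have := h _ _ (.c2wne j.castSucc j.isLt)
          rw [cstC_last_of_lt (i := j.castSucc) j.isLt] at this
          simpa [GenE.elim] using this
        | last =>
          have := h _ _ .c2wnen
          rw [cstC_last_zpow n] at this
          simpa [GenE.elim] using this
    · simpa [GenE.elim] using h _ _ (.c5e i j hij)
    · simpa [GenE.elim] using h _ _ (.c6a i j hij hi)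
    · simpa [GenE.elim] using h _ _ (.c6b i j hij hi)
    · simpa [GenE.elim] using h _ _ (.c6c i hi)
    · simpa [GenE.elim] using h _ _ (.c6d i hi)

theorem qBorelPresentation_BA (n : ℕ) : QBorelPresentation (serreDeg n) (fun i j => cstC n j i)
    (fun i => genBE n (.e i)) (fun i => genBE n (.w i)) (fun i => genBE n (.winv i)) := by
  have hlift : FreeAlgebra.lift KK (GenE.elim (fun i => genBE n (.e i))
      (fun i => genBE n (.w i)) (fun i => genBE n (.winv i))) =
      RingQuot.mkAlgHom KK (RelCE n) := by
    ext g
    cases g <;> simp [GenE.elim, genBE]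
  refine ⟨qBorel_iff_relCE.2 fun u v huv => ?_, ?_, fun C _ _ x k l h => ?_⟩
  · rw [hlift]
    exact RingQuot.mkAlgHom_rel KK huv
  · rw [eq_top_iff, ← (AlgHom.range_eq_top _).2 (RingQuot.mkAlgHom_surjective KK (RelCE n)),
      ← Algebra.map_top, ← FreeAlgebra.adjoin_range_ι, AlgHom.map_adjoin]
    refine Algebra.adjoin_mono ?_
    rintro _ ⟨_, ⟨g, rfl⟩, rfl⟩
    cases g with
    | e i => exact .inl (.inl ⟨i, rfl⟩)
    | w i => exact .inl (.inr ⟨i, rfl⟩)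
    | winv i => exact .inr ⟨i, rfl⟩
  · refine ⟨RingQuot.liftAlgHom KK ⟨FreeAlgebra.lift KK (GenE.elim x k l),
      fun u v => qBorel_iff_relCE.1 h u v⟩, ?_, ?_, ?_⟩ <;>
      simp [genBE, GenE.elim]

theorem qBorel_iff_relCF {x k l : Fin (n + 1) → C} :
    QBorel (serreDeg n) (cstC n) x k l ↔ ∀ u v, RelCF n u v →
      FreeAlgebra.lift KK (GenF.elim x k l) u =
      FreeAlgebra.lift KK (GenF.elim x k l) v := by
  have hr := qr_ne_zero
  have hs := qs_ne_zero
  have serre_succ (i j : Fin (n + 1)) (hij : (j : ℕ) = (i : ℕ) + 1) (hi : (i : ℕ) + 1 < n) :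
      x j * x i ^ 2 - (qr + qs) • (x i * x j * x i) + (qr * qs) • (x i ^ 2 * x j) = 0 ↔
        qSerre (cstC n i j) (cstC n i i) (x i) (x j) 2 = 0 := by
    apply serre_two_op_iff <;> rw [cstC_succ hij hi, cstC_self (by omega)] <;> field_simp
    ring
  have serre_pred (i j : Fin (n + 1)) (hij : (j : ℕ) = (i : ℕ) + 1) (hi : (i : ℕ) + 1 < n) :
      x i * x j ^ 2 - (qr⁻¹ + qs⁻¹) • (x j * x i * x j) + (qr * qs)⁻¹ • (x j ^ 2 * x i) = 0 ↔
        qSerre (cstC n j i) (cstC n j j) (x j) (x i) 2 = 0 := by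
    apply serre_two_op_iff <;> rw [cstC_pred hij hi, cstC_self (by omega)] <;> field_simp
  have serre_succ_last (i : Fin (n + 1)) (hi : (i : ℕ) + 1 = n) :
      x (Fin.last n) * x i ^ 3
        - (qr ^ 2 + qr * qs + qs ^ 2) • (x i * x (Fin.last n) * x i ^ 2)
        + (qr * qs * (qr ^ 2 + qr * qs + qs ^ 2)) • (x i ^ 2 * x (Fin.last n) * x i)
        - (qr * qs) ^ 3 • (x i ^ 3 * x (Fin.last n)) = 0 ↔
        qSerre (cstC n i (Fin.last n)) (cstC n i i) (x i) (x (Fin.last n)) 3 = 0 := by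
    apply serre_three_op_iff <;> rw [cstC_succ_last hi, cstC_self (by omega)] <;> field_simp
    all_goals ring
  have serre_last_pred (i : Fin (n + 1)) (hi : (i : ℕ) + 1 = n) :
      x i * x (Fin.last n) ^ 2 - ((riC n qr n)⁻¹ + (riC n qs n)⁻¹) •
        (x (Fin.last n) * x i * x (Fin.last n))
        + (riC n qr n * riC n qs n)⁻¹ • (x (Fin.last n) ^ 2 * x i) = 0 ↔
        qSerre (cstC n (Fin.last n) i) (cstC n (Fin.last n) (Fin.last n)) (x (Fin.last n)) (x i)
          2 = 0 := by
    apply serre_two_op_iff <;>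
      simp only [cstC_last_pred hi, cstC_last, riC, lt_irrefl, if_false] <;> field_simp
  have far_iff (i j : Fin (n + 1)) (hij : (i : ℕ) + 1 < j ∨ (j : ℕ) + 1 < i) :
      x i * x j - x j * x i = 0 ↔ qSerre (cstC n i j) (cstC n i i) (x i) (x j) 1 = 0 := by
    rw [cstC_far hij, commute_iff_qSerre (K := KK)]
  constructor
  · intro h u v huv
    obtain ⟨-, far, near, last⟩ := qBorel_typeC_iff.1 h
    induction huv with
    | comm g g' hg hg' =>
      simp only [map_mul, FreeAlgebra.lift_ι_apply]
      cases g <;> cases g' <;> first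
        | exact hg.elim
        | exact hg'.elim
        | simp only [GenF.elim, h.comm, h.mul_inv_comm, h.inv_comm]
    | wpinv_r i => simp [GenF.elim, h.mul_inv]
    | wpinv_l i => simp [GenF.elim, h.inv_mul]
    | c3wpf i j hj =>
      simp only [map_mul, map_smul, FreeAlgebra.lift_ι_apply, GenF.elim, cstC_of_lt_rev hj]
      exact (conj_eq_smul_iff (h.mul_inv j) (h.inv_mul j) _).2 (h.weight j i)
    | c3wpnf j hj =>
      simp only [map_mul, map_smul, FreeAlgebra.lift_ι_apply, GenF.elim, cstC_last_of_lt_rev hj]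
      exact (conj_eq_smul_iff (h.mul_inv _) (h.inv_mul _) _).2 (h.weight _ j)
    | c3wpnfn =>
      simp only [map_mul, map_smul, FreeAlgebra.lift_ι_apply, GenF.elim, cstC_last_rev n]
      exact (conj_eq_smul_iff (h.mul_inv _) (h.inv_mul _) _).2 (h.weight _ _)
    | c5f i j hij => simpa [GenF.elim] using (far_iff i j hij).2 (far i j hij)
    | c7a i j hij hi => simpa [GenF.elim] using (serre_succ i j hij hi).2 (near i j hij hi).1
    | c7b i j hij hi => simpa [GenF.elim] using (serre_pred i j hij hi).2 (near i j hij hi).2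
    | c7c i hi => simpa [GenF.elim] using (serre_succ_last i hi).2 (last i hi).1
    | c7d i hi => simpa [GenF.elim] using (serre_last_pred i hi).2 (last i hi).2
  · intro h
    have mul_inv (i) : k i * l i = 1 := by simpa [GenF.elim] using h _ _ (.wpinv_r i)
    have inv_mul (i) : l i * k i = 1 := by simpa [GenF.elim] using h _ _ (.wpinv_l i)
    refine qBorel_typeC_iff.2 ⟨⟨fun i j => ?_, mul_inv, inv_mul, fun i j => ?_⟩,
      fun i j hij => (far_iff i j hij).1 ?_,
      fun i j hij hi => ⟨(serre_succ i j hij hi).1 ?_, (serre_pred i j hij hi).1 ?_⟩,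
      fun i hi => ⟨(serre_succ_last i hi).1 ?_, (serre_last_pred i hi).1 ?_⟩⟩
    · simpa [GenF.elim] using h _ _ (.comm (.wp i) (.wp j) trivial trivial)
    · refine (conj_eq_smul_iff (mul_inv i) (inv_mul i) _).1 ?_
      induction i using Fin.lastCases with
      | cast i =>
        have := h _ _ (.c3wpf j i.castSucc i.isLt)
        rw [cstC_of_lt_rev (j := i.castSucc) i.isLt] at this
        simpa [GenF.elim] using this
      | last =>
        induction j using Fin.lastCases with
        | cast j =>
          have := h _ _ (.c3wpnf j.castSucc j.isLt)
          rw [cstC_last_of_lt_rev (i := j.castSucc) j.isLt] at this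
          simpa [GenF.elim] using this
        | last =>
          have := h _ _ .c3wpnfn
          rw [cstC_last_rev n] at this
          simpa [GenF.elim] using this
    · simpa [GenF.elim] using h _ _ (.c5f i j hij)
    · simpa [GenF.elim] using h _ _ (.c7a i j hij hi)
    · simpa [GenF.elim] using h _ _ (.c7b i j hij hi)
    · simpa [GenF.elim] using h _ _ (.c7c i hi)
    · simpa [GenF.elim] using h _ _ (.c7d i hi)

theorem qBorelPresentation_BA' (n : ℕ) : QBorelPresentation (serreDeg n) (cstC n)
    (fun i => genBF n (.f i)) (fun i => genBF n (.wp i)) (fun i => genBF n (.wpinv i)) := by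
  have hlift : FreeAlgebra.lift KK (GenF.elim (fun i => genBF n (.f i))
      (fun i => genBF n (.wp i)) (fun i => genBF n (.wpinv i))) =
      RingQuot.mkAlgHom KK (RelCF n) := by
    ext g
    cases g <;> simp [GenF.elim, genBF]
  refine ⟨qBorel_iff_relCF.2 fun u v huv => ?_, ?_, fun C _ _ x k l h => ?_⟩
  · rw [hlift]
    exact RingQuot.mkAlgHom_rel KK huv
  · rw [eq_top_iff, ← (AlgHom.range_eq_top _).2 (RingQuot.mkAlgHom_surjective KK (RelCF n)),
      ← Algebra.map_top, ← FreeAlgebra.adjoin_range_ι, AlgHom.map_adjoin]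
    refine Algebra.adjoin_mono ?_
    rintro _ ⟨_, ⟨g, rfl⟩, rfl⟩
    cases g with
    | f i => exact .inl (.inl ⟨i, rfl⟩)
    | wp i => exact .inl (.inr ⟨i, rfl⟩)
    | wpinv i => exact .inr ⟨i, rfl⟩
  · refine ⟨RingQuot.liftAlgHom KK ⟨FreeAlgebra.lift KK (GenF.elim x k l),
      fun u v => qBorel_iff_relCF.1 h u v⟩, ?_, ?_, ?_⟩ <;>
      simp [genBF, GenF.elim]

end TypeCPresentation

theorem pairCond_iff {n : ℕ} {ΔB : BA n →ₐ[KK] BA n ⊗[KK] BA n} {εB : BA n →ₐ[KK] KK}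
    {ΔB' : BA' n →ₐ[KK] BA' n ⊗[KK] BA' n} {εB' : BA' n →ₐ[KK] KK}
    {p : BA' n →ₗ[KK] BA n →ₗ[KK] KK} :
    PairCond n ΔB εB ΔB' εB' p ↔
      IsSkewPairing (K := KK) (A := BA n) (A' := BA' n) ΔB εB ΔB' εB' p ∧
      PairingValues (K := KK) (A := BA n) (A' := BA' n) (cstC n)
        (fun i => (riC n qs i - riC n qr i)⁻¹) (fun i => genBE n (.e i))
        (fun i => genBE n (.w i)) (fun i => genBE n (.winv i)) (fun i => genBF n (.f i))
        (fun i => genBF n (.wp i)) (fun i => genBF n (.wpinv i)) p :=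
  ⟨fun ⟨h₁, h₂, h₃, h₄, v₁, v₂, v₃, v₄, v₅, v₆, v₇, v₈, v₉⟩ =>
    ⟨⟨h₁, h₂, h₃, h₄⟩, ⟨v₁, v₂, v₃, v₄, v₅, v₆, v₇, v₈, v₉⟩⟩,
  fun ⟨⟨h₁, h₂, h₃, h₄⟩, ⟨v₁, v₂, v₃, v₄, v₅, v₆, v₇, v₈, v₉⟩⟩ =>
    ⟨h₁, h₂, h₃, h₄, v₁, v₂, v₃, v₄, v₅, v₆, v₇, v₈, v₉⟩⟩

theorem stmt5 (n : ℕ) :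
    ∃ (ΔB : BA n →ₐ[KK] (BA n ⊗[KK] BA n)) (εB : BA n →ₐ[KK] KK) (SB : BA n →ₗ[KK] BA n)
      (ΔB' : BA' n →ₐ[KK] (BA' n ⊗[KK] BA' n)) (εB' : BA' n →ₐ[KK] KK)
      (SB' : BA' n →ₗ[KK] BA' n),
      (∀ i : Fin (n+1),
        ΔB (genBE n (.w i)) = genBE n (.w i) ⊗ₜ[KK] genBE n (.w i) ∧
        ΔB (genBE n (.winv i)) = genBE n (.winv i) ⊗ₜ[KK] genBE n (.winv i) ∧
        ΔB (genBE n (.e i))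
          = genBE n (.e i) ⊗ₜ[KK] 1 + genBE n (.w i) ⊗ₜ[KK] genBE n (.e i)) ∧
      (∀ i : Fin (n+1), εB (genBE n (.w i)) = 1 ∧ εB (genBE n (.winv i)) = 1 ∧
        εB (genBE n (.e i)) = 0) ∧
      SB 1 = 1 ∧ (∀ x y, SB (x * y) = SB y * SB x) ∧
      (∀ i : Fin (n+1), SB (genBE n (.w i)) = genBE n (.winv i) ∧
        SB (genBE n (.winv i)) = genBE n (.w i) ∧
        SB (genBE n (.e i)) = -(genBE n (.winv i) * genBE n (.e i))) ∧
      (∀ i : Fin (n+1),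
        ΔB' (genBF n (.wp i)) = genBF n (.wp i) ⊗ₜ[KK] genBF n (.wp i) ∧
        ΔB' (genBF n (.wpinv i)) = genBF n (.wpinv i) ⊗ₜ[KK] genBF n (.wpinv i) ∧
        ΔB' (genBF n (.f i))
          = 1 ⊗ₜ[KK] genBF n (.f i) + genBF n (.f i) ⊗ₜ[KK] genBF n (.wp i)) ∧
      (∀ i : Fin (n+1), εB' (genBF n (.wp i)) = 1 ∧ εB' (genBF n (.wpinv i)) = 1 ∧
        εB' (genBF n (.f i)) = 0) ∧
      SB' 1 = 1 ∧ (∀ x y, SB' (x * y) = SB' y * SB' x) ∧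
      (∀ i : Fin (n+1), SB' (genBF n (.wp i)) = genBF n (.wpinv i) ∧
        SB' (genBF n (.wpinv i)) = genBF n (.wp i) ∧
        SB' (genBF n (.f i)) = -(genBF n (.f i) * genBF n (.wpinv i))) ∧
      (∃! p : BA' n →ₗ[KK] BA n →ₗ[KK] KK, PairCond n ΔB εB ΔB' εB' p) ∧
      (∀ p : BA' n →ₗ[KK] BA n →ₗ[KK] KK, PairCond n ΔB εB ΔB' εB' p →
        ∀ a b, p (SB' a) (SB b) = p a b) := by
  have hc := serreDatum_cstC n
  have hB := qBorelPresentation_BA n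
  have hB' := qBorelPresentation_BA' n
  obtain ⟨Δ, Δ_x, Δ_k, Δ_l⟩ := hB.exists_comul hc.transpose
  obtain ⟨ε, ε_x, ε_k, ε_l⟩ := hB.exists_counit
  obtain ⟨S, S_one, S_mul, S_x, S_k, S_l⟩ := hB.exists_antipode hc.transpose
  obtain ⟨Δ', Δ'_x, Δ'_k, Δ'_l⟩ := hB'.exists_comul_rev hc
  obtain ⟨ε', ε'_x, ε'_k, ε'_l⟩ := hB'.exists_counit
  obtain ⟨S', S'_one, S'_mul, S'_x, S'_k, S'_l⟩ := hB'.exists_antipode_rev hc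
  have H : IsBorelCoalg _ _ _ Δ ε := ⟨Δ_x, Δ_k, Δ_l, ε_x, ε_k, ε_l⟩
  have H' : IsBorelCoalgRev _ _ _ Δ' ε' := ⟨Δ'_x, Δ'_k, Δ'_l, ε'_x, ε'_k, ε'_l⟩
  refine ⟨Δ, ε, S, Δ', ε', S', fun i => ⟨Δ_k i, Δ_l i, Δ_x i⟩, fun i => ⟨ε_k i, ε_l i, ε_x i⟩,
    S_one, S_mul, fun i => ⟨S_k i, S_l i, S_x i⟩, fun i => ⟨Δ'_k i, Δ'_l i, Δ'_x i⟩,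
    fun i => ⟨ε'_k i, ε'_l i, ε'_x i⟩, S'_one, S'_mul, fun i => ⟨S'_k i, S'_l i, S'_x i⟩, ?_, ?_⟩
  · obtain ⟨p, hp, vp⟩ := exists_skewPairing hB hB' hc
      (fun i => (riC n qs i - riC n qr i)⁻¹) H H'
    refine ⟨p, pairCond_iff.2 ⟨hp, vp⟩, fun p' hp' => ?_⟩
    obtain ⟨hp', vp'⟩ := pairCond_iff.1 hp'
    exact skewPairing_unique hB hB' H' hp' vp' hp vp
  · intro p hp
    obtain ⟨hp, vp⟩ := pairCond_iff.1 hp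
    exact skewPairing_antipode hc.ne_zero hB hB' H H' S_one S_mul S_x S_k S_l S'_one S'_mul
      S'_x S'_k S'_l hp vp

end
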